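/- arXiv:2205.13309 — 2 statements merged into one kernel-verified Lean document; each statement's English description precedes it below -/
import Mathlib

section
/- For every integer d ≥ 2, the number a(d) of vertices of the White Whale H_∞^+(d,1) satisfies ((d+1)/2^{d+1}) · 2^{d²(1 − 10/ln d)} ≤ a(d) ≤ ((d+4)/2^{3(d−1)}) · 2^{d²}, where the powers of 2 with real exponents are real powers and ln denotes the natural logarithm. -/
/-- The set `G_d` of generators of the White Whale:
all nonzero 0/1-valued vectors of `ℝ^d`. -/
def whaleGens (d : ℕ) : Set (Fin d → ℝ) :=
  {g | g ≠ 0 ∧ ∀ i, g i = 0 ∨ g i = 1}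

/-- The point `p(S)`: the sum of the vectors in `S` (with `p(∅) = 0`). -/
noncomputable def whaleSum {d : ℕ} (S : Set (Fin d → ℝ)) : Fin d → ℝ :=
  ∑ᶠ g ∈ S, g

/-- The White Whale `H_∞^+(d,1)`: the convex hull of the points `p(S)`
over all subsets `S ⊆ G_d`. -/
noncomputable def whiteWhale (d : ℕ) : Set (Fin d → ℝ) :=
  convexHull ℝ {x | ∃ S : Set (Fin d → ℝ), S ⊆ whaleGens d ∧ x = whaleSum S}

/-- A vertex of the White Whale is an extreme point of it. -/
def IsWhaleVertex (d : ℕ) (x : Fin d → ℝ) : Prop :=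
  x ∈ Set.extremePoints ℝ (whiteWhale d)

/-- The family of index sets `S` for which some linear functional is positive on `v a`
exactly for `a ∈ S` and negative on the other vectors. -/
def IsSignPattern {ι E : Type*} [AddCommGroup E] [Module ℝ E] (v : ι → E) (S : Finset ι) : Prop :=
  ∃ f : E →ₗ[ℝ] ℝ, ∀ a, (a ∈ S → 0 < f (v a)) ∧ (a ∉ S → f (v a) < 0)

section Zonotope

variable {ι E : Type*} [Fintype ι] [AddCommGroup E] [Module ℝ E]

lemma sum_lt_sum_of_sign [DecidableEq ι] {g : ι → ℝ} {S T : Finset ι} (hST : T ≠ S)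
    (hS : ∀ a, (a ∈ S → 0 < g a) ∧ (a ∉ S → g a < 0)) :
    ∑ a ∈ T, g a < ∑ a ∈ S, g a := by
  have key : ∀ U : Finset ι, ∑ a ∈ U, g a = ∑ a, if a ∈ U then g a else 0 := fun U => by
    simp [Finset.sum_ite_mem]
  rw [key, key]
  have hle : ∀ a ∈ (Finset.univ : Finset ι),
      (if a ∈ T then g a else 0) ≤ if a ∈ S then g a else 0 := by
    intro a _
    by_cases h1 : a ∈ T <;> by_cases h2 : a ∈ S <;> simp only [h1, h2, if_true, if_false, le_refl]
    · exact ((hS a).2 h2).le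
    · exact ((hS a).1 h2).le
  refine Finset.sum_lt_sum hle ?_
  by_contra! hcon
  apply hST
  ext a
  have h := hcon a (Finset.mem_univ a)
  by_cases h1 : a ∈ T <;> by_cases h2 : a ∈ S <;> simp only [h1, h2, if_true, if_false] at h ⊢
  · exact absurd h (not_le.2 ((hS a).2 h2))
  · exact absurd h (not_le.2 ((hS a).1 h2))

lemma injOn_sum_isSignPattern (v : ι → E) :
    Set.InjOn (fun S : Finset ι => ∑ a ∈ S, v a) {S | IsSignPattern v S} := by
  classical
  rintro S ⟨f, hf⟩ T - hST
  by_contra hne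
  have h := sum_lt_sum_of_sign (g := fun a => f (v a)) (Ne.symm hne) hf
  rw [← map_sum, ← map_sum] at h
  exact absurd (congrArg f hST) h.ne'

lemma convex_insert_halfSpace (f : E →ₗ[ℝ] ℝ) (x : E) :
    Convex ℝ (insert x {y | f y < f x}) := by
  rw [convex_iff_forall_pos]
  intro y hy z hz a b ha hb hab
  have hle : ∀ w ∈ insert x {y | f y < f x}, f w ≤ f x := by
    rintro w (rfl | hw)
    exacts [le_rfl, le_of_lt hw]
  have hx : f x = a * f x + b * f x := by rw [← add_mul, hab, one_mul]
  rcases hy with rfl | hy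
  · rcases hz with rfl | hz
    · left
      rw [← add_smul, hab, one_smul]
    · right
      simp only [Set.mem_ofPred_eq, map_add, map_smul, smul_eq_mul] at hz ⊢
      have := mul_lt_mul_of_pos_left hz hb
      linarith
  · right
    have h2 := mul_le_mul_of_nonneg_left (hle z hz) hb.le
    simp only [Set.mem_ofPred_eq, map_add, map_smul, smul_eq_mul] at hy ⊢
    have := mul_lt_mul_of_pos_left hy ha
    linarith

lemma extremePoints_convexHull_sums [TopologicalSpace E] [IsTopologicalAddGroup E]
    [ContinuousSMul ℝ E] [T2Space E] [LocallyConvexSpace ℝ E] (v : ι → E) (hv : ∀ a, v a ≠ 0) :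
    Set.extremePoints ℝ (convexHull ℝ (Set.range fun S : Finset ι => ∑ a ∈ S, v a)) =
      (fun S : Finset ι => ∑ a ∈ S, v a) '' {S | IsSignPattern v S} := by
  classical
  set P := Set.range fun S : Finset ι => ∑ a ∈ S, v a with hP
  have hPfin : P.Finite := Set.finite_range _
  ext x
  rw [(convex_convexHull ℝ P).mem_extremePoints_iff_mem_sdiff_convexHull_sdiff]
  constructor
  · intro hx
    have hxP : x ∈ P := extremePoints_convexHull_subset
      ((convex_convexHull ℝ P).mem_extremePoints_iff_mem_sdiff_convexHull_sdiff.2 hx)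
    obtain ⟨S, rfl⟩ := hxP
    have hnot : (∑ a ∈ S, v a) ∉ convexHull ℝ (P \ {∑ a ∈ S, v a}) := fun h =>
      hx.2 (convexHull_mono (Set.sdiff_subset_sdiff_left (subset_convexHull ℝ P)) h)
    obtain ⟨f, u, hfu, hux⟩ := geometric_hahn_banach_closed_point (convex_convexHull ℝ _)
      ((hPfin.subset Set.sdiff_subset).isClosed_convexHull ℝ) hnot
    have hlt : ∀ T : Finset ι, ∑ a ∈ T, v a ≠ ∑ a ∈ S, v a →
        f (∑ a ∈ T, v a) < f (∑ a ∈ S, v a) := fun T hT =>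
      (hfu _ (subset_convexHull ℝ _ ⟨⟨T, rfl⟩, hT⟩)).trans hux
    refine ⟨S, ⟨f.toLinearMap, fun a => ⟨fun ha => ?_, fun ha => ?_⟩⟩, rfl⟩
    · have hs := Finset.add_sum_erase S v ha
      have := hlt (S.erase a) (by rw [← hs]; simpa using hv a)
      rw [← hs, map_add] at this
      simpa using this
    · have hs := Finset.sum_insert (f := v) ha
      have := hlt (insert a S) (by rw [hs]; simpa using hv a)
      rw [hs, map_add] at this
      simpa using this
  · rintro ⟨S, ⟨f, hf⟩, rfl⟩
    refine ⟨subset_convexHull ℝ _ ⟨S, rfl⟩, fun h => ?_⟩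
    have hsub : convexHull ℝ P ⊆ insert (∑ a ∈ S, v a) {y | f y < f (∑ a ∈ S, v a)} := by
      refine convexHull_min ?_ (convex_insert_halfSpace f _)
      rintro _ ⟨T, rfl⟩
      by_cases hT : T = S
      · left; rw [hT]
      · right
        have := sum_lt_sum_of_sign (g := fun a => f (v a)) hT hf
        simpa only [Set.mem_ofPred_eq, map_sum] using this
    have hsub' : convexHull ℝ (convexHull ℝ P \ {∑ a ∈ S, v a}) ⊆
        {y | f y < f (∑ a ∈ S, v a)} := by
      refine convexHull_min ?_ (convex_halfSpace_lt f.isLinear _)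
      rintro y ⟨hy, hne⟩
      exact (hsub hy).resolve_left hne
    exact lt_irrefl (f (∑ a ∈ S, v a)) (hsub' h)

end Zonotope

section Shatter

variable {ι : Type*} [Fintype ι] [DecidableEq ι]

open Classical in
/-- Dual of the Sauer–Shelah inequality: a family has at least as many members as strongly
shattered sets. -/
lemma card_stronglyShattered_le (𝒜 : Finset (Finset ι)) :
    (Finset.univ.filter fun S : Finset ι =>
      ∃ X : Finset ι, ∀ T ⊆ S, X \ S ∪ T ∈ 𝒜).card ≤ 𝒜.card := by
  set 𝒮 := Finset.univ.filter fun S : Finset ι => ∃ X : Finset ι, ∀ T ⊆ S, X \ S ∪ T ∈ 𝒜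
  have h1 : 𝒜ᶜ.card ≤ 𝒮ᶜ.card := by
    refine (Finset.card_le_card_shatterer 𝒜ᶜ).trans ?_
    refine Finset.card_le_card_of_injOn compl ?_ compl_injective.injOn
    intro S hS
    simp only [Finset.coe_compl, Set.mem_compl_iff, Finset.mem_coe, 𝒮, Finset.mem_filter,
      Finset.mem_univ, true_and] at hS ⊢
    rintro ⟨X, hX⟩
    rw [Finset.mem_shatterer] at hS
    obtain ⟨u, hu, hSu⟩ := hS (t := X \ Sᶜ) (by intro a; simp)
    have := hX (u ∩ Sᶜ) Finset.inter_subset_right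
    rw [← hSu] at this
    rw [Finset.mem_compl] at hu
    apply hu
    convert this using 1
    ext a
    simp only [Finset.mem_union, Finset.mem_inter, Finset.mem_compl]
    tauto
  rw [Finset.card_compl, Finset.card_compl] at h1
  have h2 := Finset.card_le_univ 𝒜
  have h3 := Finset.card_le_univ 𝒮
  omega

end Shatter

section SignPatternBounds

open Module Finset

variable {ι E : Type*} [Fintype ι] [DecidableEq ι] [AddCommGroup E] [Module ℝ E]

open Classical in
/-- Upper bound for the number of sign patterns of `m` vectors in dimension `d`. -/
lemma card_isSignPattern_le [FiniteDimensional ℝ E] [Nonempty ι] (v : ι → E) :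
    (univ.filter fun S : Finset ι => IsSignPattern v S).card ≤
      2 * ∑ i ∈ range (finrank ℝ E), (Fintype.card ι - 1).choose i := by
  obtain ⟨o⟩ := ‹Nonempty ι›
  set 𝒜 := univ.filter fun S : Finset ι => IsSignPattern v S
  set 𝒬 := 𝒜.filter fun S => o ∈ S with h𝒬
  have hneg : (𝒜.filter fun S => o ∉ S).card ≤ 𝒬.card := by
    refine card_le_card_of_injOn compl ?_ compl_injective.injOn
    intro S hS
    simp only [𝒜, 𝒬, coe_filter, mem_filter, mem_univ, true_and, Set.mem_ofPred_eq,
      mem_compl] at hS ⊢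
    obtain ⟨⟨f, hf⟩, ho⟩ := hS
    refine ⟨⟨-f, fun a => ?_⟩, ho⟩
    have := hf a
    simp only [mem_compl, not_not, LinearMap.neg_apply, Left.neg_pos_iff, Left.neg_neg_iff]
    exact ⟨this.2, this.1⟩
  have hsh : 𝒬.shatterer ⊆
      (range (finrank ℝ E)).biUnion fun i => powersetCard i (univ.erase o) := by
    intro S hS
    rw [mem_shatterer] at hS
    have hpat : ∀ T ⊆ S, ∃ f : E →ₗ[ℝ] ℝ, 0 < f (v o) ∧
        ∀ a ∈ S, (a ∈ T → 0 < f (v a)) ∧ (a ∉ T → f (v a) < 0) := by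
      intro T hT
      obtain ⟨u, hu, hSu⟩ := hS hT
      simp only [𝒜, 𝒬, mem_filter, mem_univ, true_and] at hu
      obtain ⟨⟨f, hf⟩, ho⟩ := hu
      refine ⟨f, (hf o).1 ho, fun a ha => ?_⟩
      have : a ∈ T ↔ a ∈ u := by rw [← hSu]; simp [ha]
      rw [this]
      exact hf a
    have hoS : o ∉ S := by
      intro ho
      obtain ⟨f, hf, hfa⟩ := hpat ∅ (empty_subset _)
      exact absurd hf (not_lt.2 ((hfa o ho).2 (notMem_empty o)).le)
    have hli : LinearIndependent ℝ (fun a : (insert o S : Finset ι) => v a) := by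
      have key : ∀ c : ι → ℝ, 0 ≤ c o → ∑ a ∈ insert o S, c a • v a = 0 →
          ∀ a ∈ insert o S, c a = 0 := by
        intro c hc hsum
        obtain ⟨f, hf, hfa⟩ := hpat (S.filter fun a => 0 < c a) (filter_subset _ _)
        have h0 : ∑ a ∈ insert o S, c a * f (v a) = 0 := by
          simpa using congrArg f hsum
        have hnn : ∀ a ∈ insert o S, 0 ≤ c a * f (v a) ∧ (c a * f (v a) = 0 → c a = 0) := by
          intro a ha
          rcases mem_insert.1 ha with rfl | ha
          · exact ⟨mul_nonneg hc hf.le, fun h => (mul_eq_zero.1 h).resolve_right hf.ne'⟩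
          · by_cases hca : 0 < c a
            · have := (hfa a ha).1 (mem_filter.2 ⟨ha, hca⟩)
              exact ⟨(mul_pos hca this).le, fun h => (mul_eq_zero.1 h).resolve_right this.ne'⟩
            · have := (hfa a ha).2 (fun h => hca (mem_filter.1 h).2)
              exact ⟨mul_nonneg_of_nonpos_of_nonpos (not_lt.1 hca) this.le,
                fun h => (mul_eq_zero.1 h).resolve_right this.ne⟩
        intro a ha
        exact (hnn a ha).2 ((sum_eq_zero_iff_of_nonneg fun b hb => (hnn b hb).1).1 h0 a ha)
      have hli' : LinearIndepOn ℝ v (insert o S : Finset ι) := by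
        rw [linearIndepOn_finset_iff]
        intro c hsum
        rcases le_total 0 (c o) with hc | hc
        · exact key c hc hsum
        · intro a ha
          have := key (-c) (by simpa using hc) (by simpa using hsum) a ha
          simpa using this
      exact hli'
    have hcard := hli.fintype_card_le_finrank
    rw [Fintype.card_coe, card_insert_of_notMem hoS] at hcard
    simp only [mem_biUnion, mem_range, mem_powersetCard]
    exact ⟨S.card, hcard, fun a ha => mem_erase.2 ⟨fun h => hoS (h ▸ ha), mem_univ a⟩, rfl⟩
  have hP : 𝒬.card ≤ ∑ i ∈ range (finrank ℝ E), (Fintype.card ι - 1).choose i := by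
    refine (card_le_card_shatterer 𝒬).trans ((card_le_card hsh).trans (card_biUnion_le.trans ?_))
    simp [card_powersetCard, card_erase_of_mem]
  have hsplit : 𝒬.card + (𝒜.filter fun S => o ∉ S).card = 𝒜.card := by
    rw [h𝒬]
    convert card_filter_add_card_filter_not (s := 𝒜) (fun S => o ∈ S)
  omega

open Classical in
/-- An independent subfamily whose span contains no further vector of the family is strongly
shattered by the sign patterns. -/
lemma exists_isSignPattern_of_linearIndepOn (v : ι → E) (B : Finset ι)
    (hB : LinearIndepOn ℝ v B) (hspan : ∀ a ∉ B, v a ∉ Submodule.span ℝ (v '' B)) :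
    ∃ X : Finset ι, ∀ T ⊆ B, IsSignPattern v (X \ B ∪ T) := by
  set W := Submodule.span ℝ (v '' B)
  obtain ⟨g, hg⟩ := exists_dual_forall_apply_ne_zero (K := ℝ)
    (fun a : {a // a ∉ B} => W.mkQ (v a))
    (fun a => by simpa [Submodule.Quotient.mk_eq_zero] using hspan a a.2)
  set f : E →ₗ[ℝ] ℝ := g ∘ₗ W.mkQ
  have hfB : ∀ a ∈ B, f (v a) = 0 := by
    intro a ha
    have : W.mkQ (v a) = 0 := by
      simpa using Submodule.subset_span (Set.mem_image_of_mem v (by exact_mod_cast ha))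
    simp [f, this]
  have hf : ∀ a ∉ B, f (v a) ≠ 0 := fun a ha => hg ⟨a, ha⟩
  refine ⟨univ.filter fun a => 0 < f (v a), fun T hT => ?_⟩
  obtain ⟨h, hh⟩ : ∃ h : E →ₗ[ℝ] ℝ, ∀ a ∈ B, h (v a) = if a ∈ T then 1 else -1 := by
    let b := Basis.span hB
    obtain ⟨h, hh⟩ := LinearMap.exists_extend
      (b.constr ℝ (fun a : (B : Set ι) => if (a : ι) ∈ T then (1 : ℝ) else -1))
    refine ⟨h, fun a ha => ?_⟩
    have h1 := LinearMap.congr_fun hh (b ⟨a, by exact_mod_cast ha⟩)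
    rw [Basis.constr_basis] at h1
    rw [← h1]
    exact congrArg h (congrArg Subtype.val (Basis.span_apply hB ⟨a, by exact_mod_cast ha⟩)).symm
  have hε : ∃ ε : ℝ, 0 < ε ∧ ∀ a ∉ B, ε * |h (v a)| < |f (v a)| := by
    have : ∀ᶠ ε in nhdsWithin (0 : ℝ) (Set.Ioi 0), ∀ a ∉ B, ε * |h (v a)| < |f (v a)| := by
      rw [Filter.eventually_all]
      intro a
      by_cases ha : a ∈ B
      · simp [ha]
      · have ht : Filter.Tendsto (fun ε : ℝ => ε * |h (v a)|) (nhdsWithin 0 (Set.Ioi 0))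
            (nhds (0 * |h (v a)|)) :=
          ((continuous_id.mul continuous_const).tendsto 0).mono_left nhdsWithin_le_nhds
        rw [zero_mul] at ht
        filter_upwards [ht.eventually_lt_const (abs_pos.2 (hf a ha))] with ε hε _ using hε
    obtain ⟨ε, h1, h2⟩ := (this.and self_mem_nhdsWithin).exists
    exact ⟨ε, h2, h1⟩
  obtain ⟨ε, hε0, hε⟩ := hε
  refine ⟨f + ε • h, fun a => ?_⟩
  by_cases ha : a ∈ B
  · by_cases haT : a ∈ T
    · simp [hfB a ha, hh a ha, haT, hε0]
    · simp [hfB a ha, hh a ha, haT, hε0, ha]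
  · have haT : a ∉ T := fun h => ha (hT h)
    have h1 := hε a ha
    have h2 : |ε * h (v a)| < |f (v a)| := by rwa [abs_mul, abs_of_pos hε0]
    have h3 := abs_lt.1 h2
    simp only [mem_union, mem_sdiff, mem_filter, mem_univ, true_and, ha, haT, not_false_eq_true,
      and_true, or_false, LinearMap.add_apply, LinearMap.smul_apply, smul_eq_mul]
    constructor
    · intro hp
      rw [abs_of_pos hp] at h3
      linarith
    · intro hp
      rw [abs_of_neg (lt_of_le_of_ne (not_lt.1 hp) (hf a ha))] at h3
      linarith

end SignPatternBounds

section LittlewoodOfford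

open Finset

variable {ι : Type*} [Fintype ι] [DecidableEq ι]

/-- The Erdős–Littlewood–Offord inequality for a single value. -/
lemma card_sum_eq_le_choose (α : ι → ℝ) (hα : ∀ i, α i ≠ 0) (x : ℝ) :
    (univ.filter fun S : Finset ι => ∑ i ∈ S, α i = x).card ≤
      (Fintype.card ι).choose (Fintype.card ι / 2) := by
  set N := univ.filter fun i => α i < 0
  have habs : ∀ S : Finset ι, ∑ i ∈ symmDiff S N, |α i| = ∑ i ∈ S, α i - ∑ i ∈ N, α i := by
    intro S
    have key : ∀ (U : Finset ι) (g : ι → ℝ), ∑ a ∈ U, g a = ∑ a, if a ∈ U then g a else 0 :=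
      fun U g => by simp [Finset.sum_ite_mem]
    rw [key, key S, key N, ← sum_sub_distrib]
    refine sum_congr rfl fun i _ => ?_
    by_cases h1 : i ∈ S <;> by_cases h2 : α i < 0
    · simp [N, mem_symmDiff, h1, h2]
    · simp [N, mem_symmDiff, h1, h2, abs_of_nonneg (not_lt.1 h2)]
    · simp [N, mem_symmDiff, h1, h2, abs_of_neg h2]
    · simp [N, mem_symmDiff, h1, h2]
  rw [← card_image_of_injective _ (symmDiff_left_injective N)]
  refine IsAntichain.sperner ?_
  intro S hS T hT hne hle
  simp only [coe_image, coe_filter, mem_univ, true_and, Set.mem_image, Set.mem_ofPred_eq] at hS hT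
  obtain ⟨S, hS, rfl⟩ := hS
  obtain ⟨T, hT, rfl⟩ := hT
  obtain ⟨i, hi⟩ := exists_of_ssubset (hle.ssubset_of_ne hne)
  have := sum_lt_sum_of_subset hle hi.1 hi.2 (abs_pos.2 (hα i)) fun j _ _ => abs_nonneg (α j)
  rw [habs, habs, hS, hT] at this
  exact lt_irrefl _ this

lemma card_sum_eq_le_choose_mul (α : ι → ℝ) (K : Finset ι) (hα : ∀ i ∈ K, α i ≠ 0) (x : ℝ) :
    (univ.filter fun S : Finset ι => ∑ i ∈ S, α i = x).card ≤
      K.card.choose (K.card / 2) * 2 ^ (Fintype.card ι - K.card) := by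
  rw [← card_compl K, ← card_powerset Kᶜ]
  refine card_le_mul_card_image_of_maps_to (f := fun S => S \ K) ?_ _ ?_
  · intro S _
    simp only [mem_powerset]
    intro i
    simp
  · intro T _
    have h := card_sum_eq_le_choose (fun i : K => α i) (fun i => hα i i.2) (x - ∑ i ∈ T, α i)
    rw [Fintype.card_coe] at h
    refine le_trans ?_ h
    refine card_le_card_of_injOn (fun S => S.subtype (· ∈ K)) ?_ ?_
    · intro S hS
      simp only [coe_filter, mem_filter, mem_univ, true_and, Set.mem_ofPred_eq] at hS ⊢
      obtain ⟨hS, rfl⟩ := hS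
      rw [← hS, sum_subtype_eq_sum_filter, ← filter_notMem_eq_sdiff, eq_sub_iff_add_eq]
      exact sum_filter_add_sum_filter_not S (· ∈ K) α
    · intro S hS S' hS' hSS
      simp only [coe_filter, mem_filter, mem_univ, true_and, Set.mem_ofPred_eq] at hS hS'
      ext i
      by_cases hi : i ∈ K
      · have := congrArg (fun U => (⟨i, hi⟩ : K) ∈ U) hSS
        simpa using this
      · have := congrArg (fun U => i ∈ U) (hS.2.trans hS'.2.symm)
        simpa [hi] using this

lemma card_sum_mem_le_choose_mul (α : ι → ℝ) (K : Finset ι) (hα : ∀ i ∈ K, α i ≠ 0) :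
    (univ.filter fun S : Finset ι => ∑ i ∈ S, α i = 0 ∨ ∑ i ∈ S, α i = 1).card ≤
      2 * (K.card.choose (K.card / 2) * 2 ^ (Fintype.card ι - K.card)) := by
  rw [filter_or, two_mul]
  exact (card_union_le _ _).trans (add_le_add (card_sum_eq_le_choose_mul α K hα 0)
    (card_sum_eq_le_choose_mul α K hα 1))

/-- Unless `α` is zero or a standard basis vector, at most three quarters of its subset sums
are `0` or `1`. -/
lemma card_sum_mem_le_three_quarters (α : ι → ℝ) (h0 : α ≠ 0) (h1 : ∀ i, α ≠ Pi.single i 1) :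
    4 * (univ.filter fun S : Finset ι => ∑ i ∈ S, α i = 0 ∨ ∑ i ∈ S, α i = 1).card ≤
      3 * 2 ^ Fintype.card ι := by
  set X := univ.filter fun S : Finset ι => ∑ i ∈ S, α i = 0 ∨ ∑ i ∈ S, α i = 1
  suffices h : ∃ U : Finset ι, U.card ≤ 2 ∧ Uᶜ.powerset ⊆ Xᶜ.image (· \ U) by
    obtain ⟨U, hU, hsub⟩ := h
    have h2 := (card_le_card hsub).trans card_image_le
    rw [card_powerset, card_compl, card_compl, Fintype.card_finset] at h2
    have h3 := card_le_univ X
    rw [Fintype.card_finset] at h3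
    have h4 : 2 ^ Fintype.card ι ≤ 4 * 2 ^ (Fintype.card ι - U.card) := by
      rw [show (4 : ℕ) = 2 ^ 2 from rfl, ← pow_add]
      exact Nat.pow_le_pow_right two_pos (by omega)
    omega
  obtain ⟨i, hi⟩ := Function.ne_iff.1 h0
  simp only [Pi.zero_apply] at hi
  have hX : ∀ S, S ∈ Xᶜ ↔ ¬ (∑ i ∈ S, α i = 0 ∨ ∑ i ∈ S, α i = 1) := fun S => by simp [X]
  by_cases hj : ∃ j, j ≠ i ∧ α j ≠ 0
  · obtain ⟨j, hji, hj⟩ := hj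
    refine ⟨{i, j}, card_le_two, fun T hT => ?_⟩
    rw [mem_powerset] at hT
    have hiT : i ∉ T := fun h => by simpa using hT h
    have hjT : j ∉ T := fun h => by simpa using hT h
    have hT0 : T \ {i, j} = T := by
      ext a
      simp only [mem_sdiff, mem_insert, mem_singleton]
      constructor
      · exact fun h => h.1
      · intro h
        refine ⟨h, ?_⟩
        rintro (rfl | rfl) <;> contradiction
    have hiJT : i ∉ insert j T := by simp [hji.symm, hiT]
    rw [mem_image]
    by_contra! hcon
    have c0 := hcon T
    have c1 := hcon (insert i T)
    have c2 := hcon (insert j T)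
    have c3 := hcon (insert i (insert j T))
    simp only [hX] at c0 c1 c2 c3
    have e1 : insert i T \ {i, j} = T := by rw [insert_sdiff_of_mem _ (by simp), hT0]
    have e2 : insert j T \ {i, j} = T := by rw [insert_sdiff_of_mem _ (by simp), hT0]
    have e3 : insert i (insert j T) \ {i, j} = T := by
      rw [insert_sdiff_of_mem _ (by simp), e2]
    rw [hT0] at c0
    rw [e1, sum_insert hiT] at c1
    rw [e2, sum_insert hjT] at c2
    rw [e3, sum_insert hiJT, sum_insert hjT] at c3
    simp only [not_or, ne_eq, not_true_eq_false, imp_false, not_and, not_not] at c0 c1 c2 c3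
    grind
  · push Not at hj
    have hαi : α i ≠ 1 := by
      intro hαi
      apply h1 i
      ext a
      by_cases ha : a = i
      · subst ha; simp [hαi]
      · simp [ha, hj a ha]
    refine ⟨{i}, by simp, fun T hT => ?_⟩
    rw [mem_powerset] at hT
    have hiT : i ∉ T := fun h => by simpa using hT h
    rw [mem_image]
    refine ⟨insert i T, ?_, ?_⟩
    · rw [hX, sum_insert hiT, sum_eq_zero fun a ha => hj a (by rintro rfl; exact hiT ha)]
      simp [hi, hαi]
    · rw [insert_sdiff_of_mem _ (by simp), sdiff_singleton_eq_erase, erase_eq_of_notMem hiT]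

lemma choose_half_sq_mul_le (n : ℕ) : n.choose (n / 2) ^ 2 * (n + 1) ≤ 4 ^ n := by
  have heven : ∀ m : ℕ, Nat.centralBinom m ^ 2 * (2 * m + 1) ≤ 4 ^ (2 * m) := by
    intro m
    induction m with
    | zero => simp
    | succ m ih =>
      have h := Nat.succ_mul_centralBinom_succ m
      have h2 : (m + 1) ^ 2 * (Nat.centralBinom (m + 1) ^ 2 * (2 * (m + 1) + 1)) ≤
          (m + 1) ^ 2 * 4 ^ (2 * (m + 1)) := by
        calc (m + 1) ^ 2 * (Nat.centralBinom (m + 1) ^ 2 * (2 * (m + 1) + 1))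
            = ((m + 1) * Nat.centralBinom (m + 1)) ^ 2 * (2 * (m + 1) + 1) := by ring
          _ = (Nat.centralBinom m ^ 2 * (2 * m + 1)) * (4 * ((2 * m + 1) * (2 * m + 3))) := by
              rw [h]; ring
          _ ≤ 4 ^ (2 * m) * (16 * (m + 1) ^ 2) := by
              refine Nat.mul_le_mul ih ?_
              nlinarith
          _ = (m + 1) ^ 2 * 4 ^ (2 * (m + 1)) := by ring
      exact Nat.le_of_mul_le_mul_left h2 (by positivity)
  obtain ⟨m, rfl | rfl⟩ := Nat.even_or_odd' n
  · rw [Nat.mul_div_cancel_left m two_pos, ← Nat.centralBinom_eq_two_mul_choose]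
    exact heven m
  · have h1 : (2 * m + 1) / 2 = m := by omega
    rw [h1]
    have h2 : 2 * (2 * m + 1).choose m = Nat.centralBinom (m + 1) := by
      rw [Nat.centralBinom_eq_two_mul_choose, show 2 * (m + 1) = 2 * m + 1 + 1 by ring,
        Nat.choose_succ_succ' (2 * m + 1) m, ← Nat.choose_symm_half m]
      ring
    have h3 := heven (m + 1)
    rw [← h2] at h3
    have h4 : 4 ^ (2 * (m + 1)) = 4 * 4 ^ (2 * m + 1) := by ring
    rw [h4] at h3
    nlinarith [h3, Nat.zero_le ((2 * m + 1).choose m ^ 2)]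

end LittlewoodOfford

section RowCounting

open Finset

variable {ι : Type*} [Fintype ι] [DecidableEq ι]

/-- A 0/1 matrix with `n` rows (given as subsets of `ι`) has `#J` rows controlling the products
with vectors supported in `J`. -/
lemma exists_controlling_rows {n : ℕ} (A : Fin n → Finset ι) (J : Finset ι) (hJ : J.card ≤ n) :
    ∃ I : Finset (Fin n), I.card = J.card ∧ ∀ β : ι → ℝ, (∀ j ∉ J, β j = 0) →
      (∀ i ∈ I, ∑ j ∈ A i, β j = 0) → ∀ i, ∑ j ∈ A i, β j = 0 := by
  set r : Fin n → J → ℝ := fun i j => if (j : ι) ∈ A i then 1 else 0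
  obtain ⟨κ, a, ha, hspan, hli⟩ := exists_linearIndependent' ℝ r
  have : Fintype κ := Fintype.ofInjective a ha
  have hκ : Fintype.card κ ≤ J.card := by
    simpa using hli.fintype_card_le_finrank
  obtain ⟨I, haI, -, hI⟩ := exists_subsuperset_card_eq (s := univ.map ⟨a, ha⟩) (t := univ)
    (n := J.card) (subset_univ _) (by simpa using hκ) (by simpa using hJ)
  refine ⟨I, hI, fun β hβ hIβ => ?_⟩
  set φ : (J → ℝ) →ₗ[ℝ] ℝ := ∑ j : J, β j • LinearMap.proj j
  have hφ : ∀ i, φ (r i) = ∑ j ∈ A i, β j := by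
    intro i
    have h1 : φ (r i) = ∑ j : J, if (j : ι) ∈ A i then β j else 0 := by
      simp [φ, r, LinearMap.sum_apply]
    rw [h1, sum_coe_sort J (fun j => if j ∈ A i then β j else 0), ← sum_filter,
      filter_mem_eq_inter, inter_comm]
    refine sum_subset inter_subset_left fun j hj hj' => hβ j fun hjJ => hj' ?_
    exact mem_inter.2 ⟨hj, hjJ⟩
  have hle : Submodule.span ℝ (Set.range r) ≤ LinearMap.ker φ := by
    rw [← hspan, Submodule.span_le]
    rintro _ ⟨k, rfl⟩
    have hk : a k ∈ I := haI (by simp)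
    simp [hφ, hIβ _ hk]
  intro i
  rw [← hφ]
  exact hle (Submodule.subset_span ⟨i, rfl⟩)

open Classical in
lemma card_rows_with_solution_le {n M : ℕ} (P : Set (ι → ℝ))
    (hM : ∀ α ∈ P, (univ.filter fun S : Finset ι =>
      ∑ i ∈ S, α i = 0 ∨ ∑ i ∈ S, α i = 1).card ≤ M) (I b : Finset (Fin n)) :
    (univ.filter fun A : Fin n → Finset ι => ∃ α ∈ P,
      (∀ i ∈ I, ∑ j ∈ A i, α j = if i ∈ b then 1 else 0) ∧
      ∀ α' ∈ P, (∀ i ∈ I, ∑ j ∈ A i, α' j = if i ∈ b then 1 else 0) →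
        ∀ i, ∑ j ∈ A i, α' j = 0 ∨ ∑ j ∈ A i, α' j = 1).card ≤
      M ^ (n - I.card) * (2 ^ Fintype.card ι) ^ I.card := by
  have hcard : (univ : Finset (I → Finset ι)).card = (2 ^ Fintype.card ι) ^ I.card := by
    simp
  rw [← hcard]
  refine card_le_mul_card_image_of_maps_to (f := fun A (i : I) => A i)
    (fun _ _ => mem_univ _) _ fun R _ => ?_
  rcases eq_empty_or_nonempty (filter (fun A => (fun i : I => A i) = R)
    (univ.filter fun A : Fin n → Finset ι => ∃ α ∈ P,
      (∀ i ∈ I, ∑ j ∈ A i, α j = if i ∈ b then 1 else 0) ∧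
      ∀ α' ∈ P, (∀ i ∈ I, ∑ j ∈ A i, α' j = if i ∈ b then 1 else 0) →
        ∀ i, ∑ j ∈ A i, α' j = 0 ∨ ∑ j ∈ A i, α' j = 1)) with he | ⟨A₀, hA₀⟩
  · rw [he]; simp
  simp only [mem_filter, mem_univ, true_and] at hA₀
  obtain ⟨⟨α, hαP, hα, -⟩, hR⟩ := hA₀
  set X := univ.filter fun S : Finset ι => ∑ i ∈ S, α i = 0 ∨ ∑ i ∈ S, α i = 1
  have hsub : (filter (fun A => (fun i : I => A i) = R)
      (univ.filter fun A : Fin n → Finset ι => ∃ α ∈ P,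
      (∀ i ∈ I, ∑ j ∈ A i, α j = if i ∈ b then 1 else 0) ∧
      ∀ α' ∈ P, (∀ i ∈ I, ∑ j ∈ A i, α' j = if i ∈ b then 1 else 0) →
        ∀ i, ∑ j ∈ A i, α' j = 0 ∨ ∑ j ∈ A i, α' j = 1)) ⊆
      Fintype.piFinset fun i => if i ∈ I then {A₀ i} else X := by
    intro A hA
    simp only [mem_filter, mem_univ, true_and] at hA
    obtain ⟨⟨_, _, _, hA⟩, hAR⟩ := hA
    have hAA : ∀ i ∈ I, A i = A₀ i := fun i hi => congrFun (hAR.trans hR.symm) ⟨i, hi⟩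
    rw [Fintype.mem_piFinset]
    intro i
    by_cases hi : i ∈ I
    · simp [hi, hAA i hi]
    · simp only [hi, if_false, X, mem_filter, mem_univ, true_and]
      exact hA α hαP (fun i hi => by rw [hAA i hi]; exact hα i hi) i
  refine (card_le_card hsub).trans ?_
  rw [Fintype.card_piFinset]
  have : ∀ i, (if i ∈ I then {A₀ i} else X : Finset (Finset ι)).card =
      if i ∈ I then 1 else X.card := fun i => by split_ifs <;> simp
  simp only [this]
  rw [prod_ite, prod_const_one, one_mul, prod_const]
  have hc : (univ.filter fun i => i ∉ I).card = n - I.card := by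
    rw [← compl_filter, card_compl, filter_univ_mem, Fintype.card_fin]
  rw [hc]
  exact Nat.pow_le_pow_left (hM α hαP) _

open Classical in
/-- Odlyzko's counting bound for 0/1 matrices sending some vector of `P` to a 0/1 vector. -/
lemma card_rows_le {n M : ℕ} (J : Finset ι) (hJ : J.card ≤ n) (P : Set (ι → ℝ))
    (hP : ∀ α ∈ P, ∀ j ∉ J, α j = 0)
    (hM : ∀ α ∈ P, (univ.filter fun S : Finset ι =>
      ∑ i ∈ S, α i = 0 ∨ ∑ i ∈ S, α i = 1).card ≤ M) :
    (univ.filter fun A : Fin n → Finset ι => ∃ α ∈ P,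
      ∀ i, ∑ j ∈ A i, α j = 0 ∨ ∑ j ∈ A i, α j = 1).card ≤
      n.choose J.card * (2 ^ J.card *
        (M ^ (n - J.card) * (2 ^ Fintype.card ι) ^ J.card)) := by
  have hsub : (univ.filter fun A : Fin n → Finset ι => ∃ α ∈ P,
      ∀ i, ∑ j ∈ A i, α j = 0 ∨ ∑ j ∈ A i, α j = 1) ⊆
      (powersetCard J.card univ).biUnion fun I => I.powerset.biUnion fun b =>
        univ.filter fun A : Fin n → Finset ι => ∃ α ∈ P,
      (∀ i ∈ I, ∑ j ∈ A i, α j = if i ∈ b then 1 else 0) ∧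
      ∀ α' ∈ P, (∀ i ∈ I, ∑ j ∈ A i, α' j = if i ∈ b then 1 else 0) →
        ∀ i, ∑ j ∈ A i, α' j = 0 ∨ ∑ j ∈ A i, α' j = 1 := by
    intro A hA
    simp only [mem_filter, mem_univ, true_and] at hA
    obtain ⟨α, hαP, hα⟩ := hA
    obtain ⟨I, hI, hctl⟩ := exists_controlling_rows A J hJ
    have hb : ∀ i ∈ I, ∑ j ∈ A i, α j =
        if i ∈ I.filter (fun i => ∑ j ∈ A i, α j = 1) then 1 else 0 := by
      intro i hi
      rcases hα i with h | h <;> simp [h, hi]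
    simp only [mem_biUnion, mem_powersetCard, mem_powerset, mem_filter, mem_univ, true_and]
    refine ⟨I, ⟨subset_univ _, hI⟩, I.filter (fun i => ∑ j ∈ A i, α j = 1), filter_subset _ _,
      α, hαP, ?_, ?_⟩
    · simpa using hb
    · intro α' hα' h i
      have hd := hctl (α - α') (fun j hj => by simp [hP α hαP j hj, hP α' hα' j hj])
        (fun i hi => by
          simp only [Pi.sub_apply, sum_sub_distrib]
          exact sub_eq_zero.2 ((hb i hi).trans (h i hi).symm)) i
      simp only [Pi.sub_apply, sum_sub_distrib, sub_eq_zero] at hd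
      rw [← hd]
      exact hα i
  refine (card_le_card hsub).trans ?_
  have hc : (powersetCard J.card (univ : Finset (Fin n))).card = n.choose J.card := by simp
  rw [← hc]
  refine card_biUnion_le_card_mul _ _ _ fun I hI => ?_
  have hIJ := (mem_powersetCard.1 hI).2
  rw [← hIJ, ← card_powerset]
  exact card_biUnion_le_card_mul _ _ _ fun b _ => card_rows_with_solution_le P hM I b

end RowCounting

open Finset in
/-- A 0/1 matrix (rows given as subsets of `Fin k`) is rigid if it sends only `0` and the
standard basis vectors to 0/1 vectors. -/
def IsRigid {d k : ℕ} (A : Fin d → Finset (Fin k)) : Prop :=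
  ∀ α : Fin k → ℝ, α ≠ 0 → (∀ j, α ≠ Pi.single j 1) →
    ¬ ∀ i, ∑ j ∈ A i, α j = 0 ∨ ∑ j ∈ A i, α j = 1

/-- The `j`-th column of a 0/1 matrix whose rows are given as subsets of `Fin k`. -/
def matrixColumn {d k : ℕ} (A : Fin d → Finset (Fin k)) (j : Fin k) : Fin d → ℝ :=
  fun i => if j ∈ A i then 1 else 0

section Rigid

open Finset

variable {d k : ℕ} {A : Fin d → Finset (Fin k)}

lemma sum_smul_matrixColumn (A : Fin d → Finset (Fin k)) (α : Fin k → ℝ) (i : Fin d) :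
    (∑ j, α j • matrixColumn A j) i = ∑ j ∈ A i, α j := by
  simp [matrixColumn, Finset.sum_apply]

lemma IsRigid.linearIndependent (hA : IsRigid A) : LinearIndependent ℝ (matrixColumn A) := by
  rw [Fintype.linearIndependent_iff]
  intro α hα
  have hrow : ∀ i, ∑ j ∈ A i, α j = 0 := fun i => by
    rw [← sum_smul_matrixColumn, hα, Pi.zero_apply]
  by_contra hne
  have h0 : α ≠ 0 := fun h => hne fun i => by simp [h]
  have h1 : ∃ j, α = Pi.single j 1 := by
    by_contra! h
    exact hA α h0 h fun i => Or.inl (hrow i)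
  have h2 : ∃ j, (2 : ℝ) • α = Pi.single j 1 := by
    by_contra! h
    refine hA ((2 : ℝ) • α) (smul_ne_zero two_ne_zero h0) h fun i => Or.inl ?_
    simp [← mul_sum, hrow i]
  obtain ⟨j, rfl⟩ := h1
  obtain ⟨l, hl⟩ := h2
  have := congrFun hl j
  by_cases hjl : j = l
  · subst hjl; simp at this
  · simp [hjl] at this

lemma IsRigid.matrixColumn_mem (hA : IsRigid A) (j : Fin k) : matrixColumn A j ∈ whaleGens d :=
  ⟨hA.linearIndependent.ne_zero j, fun i => by
    by_cases h : j ∈ A i <;> simp [matrixColumn, h]⟩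

lemma IsRigid.mem_range_of_mem_span (hA : IsRigid A) {g : Fin d → ℝ} (hg : g ∈ whaleGens d)
    (hs : g ∈ Submodule.span ℝ (Set.range (matrixColumn A))) :
    g ∈ Set.range (matrixColumn A) := by
  rw [Submodule.mem_span_range_iff_exists_fun] at hs
  obtain ⟨α, rfl⟩ := hs
  have h0 : α ≠ 0 := by
    rintro rfl
    exact hg.1 (by simp)
  have h1 : ∃ j, α = Pi.single j 1 := by
    by_contra! h
    refine hA α h0 h fun i => ?_
    rw [← sum_smul_matrixColumn]
    exact hg.2 i
  obtain ⟨j, rfl⟩ := h1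
  exact ⟨j, by simp [Pi.single_apply]⟩

lemma finite_whaleGens (d : ℕ) : (whaleGens d).Finite := by
  refine (Set.Finite.pi' (t := fun _ : Fin d => ({0, 1} : Set ℝ)) fun _ => Set.toFinite _).subset ?_
  intro g hg i
  simpa using hg.2 i

noncomputable instance (d : ℕ) : Fintype (whaleGens d) := (finite_whaleGens d).fintype

lemma card_whaleGens (d : ℕ) : Fintype.card (whaleGens d) = 2 ^ d - 1 := by
  classical
  have e : whaleGens d = ((univ : Finset (Finset (Fin d))).erase ∅).image
      (fun S i => if i ∈ S then (1 : ℝ) else 0) := by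
    ext g
    simp only [whaleGens, coe_image, coe_erase, coe_univ, Set.mem_image, Set.mem_sdiff, Set.mem_univ,
      Set.mem_singleton_iff, true_and, Set.mem_ofPred_eq]
    constructor
    · rintro ⟨h0, h⟩
      have hg : (fun i => if i ∈ univ.filter (fun i => g i = 1) then (1 : ℝ) else 0) = g := by
        ext i
        rcases h i with h | h <;> simp [h]
      refine ⟨univ.filter fun i => g i = 1, fun he => h0 ?_, hg⟩
      rw [← hg, he]
      ext i
      simp
    · rintro ⟨S, hS, rfl⟩
      refine ⟨fun h => hS ?_, fun i => ?_⟩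
      · ext i
        have := congrFun h i
        simpa using this
      · by_cases h : i ∈ S <;> simp [h]
  have hinj : Function.Injective (fun (S : Finset (Fin d)) i => if i ∈ S then (1 : ℝ) else 0) := by
    intro S T h
    ext i
    have := congrFun h i
    by_cases h1 : i ∈ S <;> by_cases h2 : i ∈ T <;> simp_all
  rw [← Nat.card_eq_fintype_card, Nat.card_coe_set_eq, e, Set.ncard_coe_finset,
    card_image_of_injective _ hinj, card_erase_of_mem (mem_univ _)]
  simp

lemma whiteWhale_eq (d : ℕ) : whiteWhale d = convexHull ℝ
    (Set.range fun S : Finset (whaleGens d) => ∑ a ∈ S, (a : Fin d → ℝ)) := by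
  classical
  unfold whiteWhale
  congr 1
  ext x
  simp only [Set.mem_ofPred_eq, Set.mem_range, whaleSum]
  constructor
  · rintro ⟨S, hS, rfl⟩
    refine ⟨univ.filter fun a => (a : Fin d → ℝ) ∈ S, ?_⟩
    have hfin := (finite_whaleGens d).subset hS
    rw [finsum_mem_eq_finite_toFinset_sum _ hfin]
    refine sum_bij (fun a _ => (a : Fin d → ℝ)) ?_ ?_ ?_ ?_
    · intro a ha
      simpa using ha
    · intro a _ b _ h
      exact Subtype.ext h
    · intro b hb
      exact ⟨⟨b, hS (by simpa using hb)⟩, by simpa using hb, rfl⟩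
    · intro a _
      rfl
  · rintro ⟨S, rfl⟩
    refine ⟨S.map (Function.Embedding.subtype _), ?_, ?_⟩
    · intro a
      simp only [coe_map, Set.mem_image]
      rintro ⟨b, -, rfl⟩
      exact b.2
    · rw [finsum_mem_coe_finset, sum_map]
      rfl

open Classical in
/-- The vertices of the White Whale are counted by the sign patterns of its generators. -/
lemma ncard_vertices_eq (d : ℕ) : (Set.extremePoints ℝ (whiteWhale d)).ncard =
    (univ.filter fun S : Finset (whaleGens d) =>
      IsSignPattern (fun a : whaleGens d => (a : Fin d → ℝ)) S).card := by
  rw [whiteWhale_eq, extremePoints_convexHull_sums _ fun a => a.2.1,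
    (injOn_sum_isSignPattern _).ncard_image, ← Set.ncard_coe_finset]
  simp

open Classical in
lemma card_isRigid_le (d k : ℕ) :
    (univ.filter fun A : Fin d → Finset (Fin k) => IsRigid A).card ≤
      k ^ k * (Set.extremePoints ℝ (whiteWhale d)).ncard := by
  set v := fun a : whaleGens d => (a : Fin d → ℝ)
  set B : (Fin d → Finset (Fin k)) → Finset (whaleGens d) := fun A =>
    univ.filter fun a => ∃ j, matrixColumn A j = a
  rw [ncard_vertices_eq]
  refine le_trans ?_ (Nat.mul_le_mul_left _ (card_stronglyShattered_le
    (univ.filter fun S : Finset (whaleGens d) => IsSignPattern v S)))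
  refine card_le_mul_card_image_of_maps_to (f := B) ?_ _ ?_
  · intro A hA
    simp only [mem_filter, mem_univ, true_and] at hA ⊢
    have himg : v '' (B A) = Set.range (matrixColumn A) := by
      ext g
      simp only [B, v, coe_filter, mem_univ, true_and, Set.mem_image, Set.mem_ofPred_eq,
        Set.mem_range]
      constructor
      · rintro ⟨a, ⟨j, hj⟩, rfl⟩
        exact ⟨j, hj⟩
      · rintro ⟨j, rfl⟩
        exact ⟨⟨_, hA.matrixColumn_mem j⟩, ⟨j, rfl⟩, rfl⟩
    refine exists_isSignPattern_of_linearIndepOn v (B A) ?_ ?_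
    · rw [linearIndepOn_iff_image Subtype.val_injective.injOn, himg]
      exact hA.linearIndependent.linearIndepOn_id
    · intro a ha hspan
      rw [himg] at hspan
      obtain ⟨j, hj⟩ := hA.mem_range_of_mem_span a.2 hspan
      exact ha (by simpa [B] using ⟨j, hj⟩)
  · intro S _
    rcases eq_empty_or_nonempty
      ((univ.filter fun A : Fin d → Finset (Fin k) => IsRigid A).filter fun A => B A = S) with
      he | ⟨A₀, hA₀⟩
    · rw [he]; simp
    have h1 : (Fintype.piFinset fun _ : Fin k => univ.image (matrixColumn A₀)).card ≤ k ^ k := by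
      rw [Fintype.card_piFinset_const]
      exact Nat.pow_le_pow_left (card_image_le.trans (by simp)) _
    refine le_trans ?_ h1
    simp only [mem_filter, mem_univ, true_and] at hA₀
    refine card_le_card_of_injOn matrixColumn ?_ ?_
    · intro A hA
      simp only [coe_filter, mem_filter, mem_univ, true_and, Set.mem_ofPred_eq] at hA
      simp only [mem_coe, Fintype.mem_piFinset]
      intro j
      have hAA := hA.2.trans hA₀.2.symm
      have : (⟨_, hA.1.matrixColumn_mem j⟩ : whaleGens d) ∈ B A₀ := by
        rw [← hAA]
        simp [B]
      simpa [B] using this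
    · intro A _ A' _ h
      ext i j
      have := congrFun (congrFun h j) i
      simp only [matrixColumn] at this
      by_cases h1 : j ∈ A i <;> by_cases h2 : j ∈ A' i <;> simp_all

open Classical in
lemma card_not_isRigid_le {d k s : ℕ} (hkd : k ≤ d) (hsk : s ≤ k) (hk : 2 ≤ k) :
    (univ.filter fun A : Fin d → Finset (Fin k) => ¬ IsRigid A).card ≤
      d.choose k * (2 ^ k * ((2 * (s.choose (s / 2) * 2 ^ (k - s))) ^ (d - k) * (2 ^ k) ^ k)) +
      k.choose s * (d.choose s * (2 ^ s * ((3 * 2 ^ (k - 2)) ^ (d - s) * (2 ^ k) ^ s))) := by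
  set P : Set (Fin k → ℝ) := {α | ∃ K : Finset (Fin k), K.card = s ∧ ∀ j ∈ K, α j ≠ 0}
  set Q : Finset (Fin k) → Set (Fin k → ℝ) := fun J =>
    {α | (α ≠ 0 ∧ ∀ j, α ≠ Pi.single j 1) ∧ ∀ j ∉ J, α j = 0}
  have hsub : (univ.filter fun A : Fin d → Finset (Fin k) => ¬ IsRigid A) ⊆
      (univ.filter fun A : Fin d → Finset (Fin k) => ∃ α ∈ P,
        ∀ i, ∑ j ∈ A i, α j = 0 ∨ ∑ j ∈ A i, α j = 1) ∪
      (powersetCard s univ).biUnion fun J =>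
        univ.filter fun A : Fin d → Finset (Fin k) => ∃ α ∈ Q J,
          ∀ i, ∑ j ∈ A i, α j = 0 ∨ ∑ j ∈ A i, α j = 1 := by
    intro A hA
    have hA' := (mem_filter.1 hA).2
    unfold IsRigid at hA'
    push Not at hA'
    obtain ⟨α, h0, h1, hα⟩ := hA'
    simp only [mem_union, mem_biUnion, mem_filter, mem_univ, true_and, mem_powersetCard]
    rcases le_total s (univ.filter fun j => α j ≠ 0).card with hs | hs
    · left
      obtain ⟨K, hK, hKs⟩ := exists_subset_card_eq hs
      exact ⟨α, ⟨K, hKs, fun j hj => (mem_filter.1 (hK hj)).2⟩, hα⟩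
    · right
      obtain ⟨J, hJ, -, hJs⟩ := exists_subsuperset_card_eq (subset_univ _) hs (by simpa using hsk)
      refine ⟨J, ⟨subset_univ _, hJs⟩, α, ⟨⟨h0, h1⟩, fun j hj => ?_⟩, hα⟩
      by_contra h
      exact hj (hJ (by simpa using h))
  refine (card_le_card hsub).trans ((card_union_le _ _).trans (add_le_add ?_ ?_))
  · have := card_rows_le (n := d) (M := 2 * (s.choose (s / 2) * 2 ^ (k - s)))
      (univ : Finset (Fin k)) (by simpa using hkd) P (by simp) (by
        rintro α ⟨K, rfl, hK⟩
        simpa using card_sum_mem_le_choose_mul α K hK)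
    simpa using this
  · have hc : (powersetCard s (univ : Finset (Fin k))).card = k.choose s := by simp
    rw [← hc]
    refine card_biUnion_le_card_mul _ _ _ fun J hJ => ?_
    have hJs := (mem_powersetCard.1 hJ).2
    have := card_rows_le (n := d) (M := 3 * 2 ^ (k - 2)) J (by omega) (Q J)
      (fun α hα => hα.2) (by
        rintro α ⟨⟨h0, h1⟩, -⟩
        have := card_sum_mem_le_three_quarters α h0 h1
        rw [Fintype.card_fin] at this
        have h2 : 2 ^ k = 4 * 2 ^ (k - 2) := by
          rw [show (4 : ℕ) = 2 ^ 2 from rfl, ← pow_add]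
          congr 1
          omega
        omega)
    simpa [hJs] using this

lemma two_pow_le_ncard_vertices {d k s : ℕ} (hkd : k ≤ d) (hsk : s ≤ k) (hk : 2 ≤ k) :
    (2 ^ k) ^ d ≤ k ^ k * (Set.extremePoints ℝ (whiteWhale d)).ncard +
      (d.choose k * (2 ^ k * ((2 * (s.choose (s / 2) * 2 ^ (k - s))) ^ (d - k) * (2 ^ k) ^ k)) +
      k.choose s * (d.choose s * (2 ^ s * ((3 * 2 ^ (k - 2)) ^ (d - s) * (2 ^ k) ^ s)))) := by
  classical
  have h := card_filter_add_card_filter_not (s := (univ : Finset (Fin d → Finset (Fin k)))) IsRigid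
  have h1 : (univ : Finset (Fin d → Finset (Fin k))).card = (2 ^ k) ^ d := by simp
  rw [← h1, ← h]
  exact add_le_add (card_isRigid_le d k) (card_not_isRigid_le hkd hsk hk)

end Rigid

section Estimates

open Finset

lemma factorial_mul_sum_choose_le (N k : ℕ) (hk : 2 * k ≤ N) :
    k.factorial * ∑ i ∈ range (k + 1), N.choose i ≤ 2 * N ^ k := by
  induction k with
  | zero => simp
  | succ k ih =>
    have h1 := ih (by omega)
    have h2 : (k + 1).factorial * N.choose (k + 1) ≤ N ^ (k + 1) := by
      rw [← Nat.descFactorial_eq_factorial_mul_choose]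
      exact Nat.descFactorial_le_pow N (k + 1)
    rw [sum_range_succ, mul_add]
    calc (k + 1).factorial * ∑ i ∈ range (k + 1), N.choose i +
          (k + 1).factorial * N.choose (k + 1)
        ≤ (k + 1) * (2 * N ^ k) + N ^ (k + 1) := by
          refine add_le_add ?_ h2
          rw [Nat.factorial_succ, mul_assoc]
          exact Nat.mul_le_mul_left _ h1
      _ ≤ N * N ^ k + N ^ (k + 1) := by
          refine Nat.add_le_add_right ?_ _
          rw [← mul_assoc]
          exact Nat.mul_le_mul_right _ (by omega)
      _ = 2 * N ^ (k + 1) := by ring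

lemma two_pow_le_mul_factorial (d : ℕ) (hd : 8 ≤ d) :
    2 ^ (2 * d - 1) ≤ (d + 4) * (d - 1).factorial := by
  induction d, hd using Nat.le_induction with
  | base => decide
  | succ d hd ih =>
    have e1 : 2 ^ (2 * (d + 1) - 1) = 4 * 2 ^ (2 * d - 1) := by
      rw [show 2 * (d + 1) - 1 = (2 * d - 1) + 2 by omega, pow_add]
      ring
    have e2 : (d + 1 - 1).factorial = d * (d - 1).factorial := by
      rw [Nat.add_sub_cancel, Nat.mul_factorial_pred (by omega)]
    rw [e1, e2]
    calc 4 * 2 ^ (2 * d - 1) ≤ 4 * ((d + 4) * (d - 1).factorial) := Nat.mul_le_mul_left _ ih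
      _ = (4 * (d + 4)) * (d - 1).factorial := by ring
      _ ≤ ((d + 1 + 4) * d) * (d - 1).factorial := Nat.mul_le_mul_right _ (by nlinarith)
      _ = (d + 1 + 4) * (d * (d - 1).factorial) := by ring

lemma sum_choose_two_pow_le (d : ℕ) (hd : 2 ≤ d) :
    2 ^ (3 * (d - 1)) * (2 * ∑ i ∈ range d, (2 ^ d - 1 - 1).choose i) ≤
      (d + 4) * 2 ^ (d ^ 2) := by
  rcases lt_or_ge d 8 with h8 | h8
  · interval_cases d <;>
      norm_num [sum_range_succ, Nat.choose_eq_descFactorial_div_factorial, Nat.descFactorial,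
        Nat.factorial]
  · obtain ⟨k, rfl⟩ : ∃ k, d = k + 1 := ⟨d - 1, by omega⟩
    have hN : 2 * k ≤ 2 ^ (k + 1) - 1 - 1 := by
      have := Nat.lt_two_pow_self (n := k)
      rw [pow_succ]
      omega
    have h1 := factorial_mul_sum_choose_le _ k hN
    have h2 : (2 ^ (k + 1) - 1 - 1) ^ k ≤ 2 ^ ((k + 1) * k) := by
      rw [pow_mul]
      exact Nat.pow_le_pow_left (by omega) k
    have h3 := two_pow_le_mul_factorial (k + 1) h8
    rw [Nat.add_sub_cancel] at h3 ⊢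
    refine Nat.le_of_mul_le_mul_left ?_ k.factorial_pos
    calc k.factorial * (2 ^ (3 * k) * (2 * ∑ i ∈ range (k + 1), (2 ^ (k + 1) - 1 - 1).choose i))
        = 2 ^ (3 * k) * (2 * (k.factorial *
            ∑ i ∈ range (k + 1), (2 ^ (k + 1) - 1 - 1).choose i)) := by ring
      _ ≤ 2 ^ (3 * k) * (2 * (2 * 2 ^ ((k + 1) * k))) := by
          refine Nat.mul_le_mul_left _ (Nat.mul_le_mul_left _ (h1.trans ?_))
          exact Nat.mul_le_mul_left _ h2
      _ = 2 ^ (2 * (k + 1) - 1) * 2 ^ ((k + 1) ^ 2) := by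
          rw [← pow_succ', ← pow_succ', ← pow_add, ← pow_add]
          congr 1
          rw [show 2 * (k + 1) - 1 = 2 * k + 1 by omega]
          ring
      _ ≤ ((k + 1 + 4) * k.factorial) * 2 ^ ((k + 1) ^ 2) := Nat.mul_le_mul_right _ h3
      _ = k.factorial * ((k + 1 + 4) * 2 ^ ((k + 1) ^ 2)) := by ring

lemma four_mul_dense_term_le {d k s : ℕ} (hkd : k ≤ d) (hsk : s ≤ k) (hd : 2 ≤ d)
    (hs : d ≤ (s + 1) ^ 2) (ht : 2 ^ (12 * d) ≤ d ^ (d - k)) :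
    4 * (d.choose k * (2 ^ k * ((2 * (s.choose (s / 2) * 2 ^ (k - s))) ^ (d - k) *
      (2 ^ k) ^ k))) ≤ (2 ^ k) ^ d := by
  obtain ⟨t, rfl⟩ := Nat.exists_eq_add_of_le hkd
  obtain ⟨r, rfl⟩ := Nat.exists_eq_add_of_le hsk
  rw [Nat.add_sub_cancel_left] at ht ⊢
  rw [Nat.add_sub_cancel_left]
  set c := s.choose (s / 2)
  have hc : (2 * (c * 2 ^ r)) ^ 4 * (s + r + t) ≤ 2 ^ (4 * (s + r) + 4) := by
    calc (2 * (c * 2 ^ r)) ^ 4 * (s + r + t) ≤ (2 * (c * 2 ^ r)) ^ 4 * (s + 1) ^ 2 :=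
          Nat.mul_le_mul_left _ hs
      _ = (c ^ 2 * (s + 1)) ^ 2 * (16 * 2 ^ (4 * r)) := by ring
      _ ≤ (4 ^ s) ^ 2 * (16 * 2 ^ (4 * r)) := by
          gcongr
          exact choose_half_sq_mul_le s
      _ = 2 ^ (4 * (s + r) + 4) := by
          rw [show (4 : ℕ) ^ s = 2 ^ (2 * s) by rw [pow_mul]; norm_num, show (16 : ℕ) = 2 ^ 4 by norm_num]
          ring
  generalize 2 * (c * 2 ^ r) = M at hc ⊢
  have hch := Nat.choose_le_two_pow (s + r + t) (s + r)
  refine le_of_pow_le_pow_left₀ (n := 4) (by norm_num) (Nat.zero_le _) ?_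
  refine Nat.le_of_mul_le_mul_right ?_ (Nat.pow_pos (n := t) (show 0 < s + r + t by omega))
  calc (4 * ((s + r + t).choose (s + r) * (2 ^ (s + r) * (M ^ t *
        (2 ^ (s + r)) ^ (s + r))))) ^ 4 * (s + r + t) ^ t
      = 2 ^ 8 * (s + r + t).choose (s + r) ^ 4 * 2 ^ (4 * (s + r)) *
        (M ^ 4 * (s + r + t)) ^ t * 2 ^ (4 * (s + r) * (s + r)) := by
        rw [mul_pow (M ^ 4)]
        ring
    _ ≤ 2 ^ 8 * (2 ^ (s + r + t)) ^ 4 * 2 ^ (4 * (s + r)) *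
        (2 ^ (4 * (s + r) + 4)) ^ t * 2 ^ (4 * (s + r) * (s + r)) := by gcongr
    _ = 2 ^ (8 + 8 * (s + r + t)) * ((2 ^ (s + r)) ^ (s + r + t)) ^ 4 := by
        simp only [← pow_mul, ← pow_add]
        congr 1
        ring
    _ ≤ ((2 ^ (s + r)) ^ (s + r + t)) ^ 4 * (s + r + t) ^ t := by
        rw [mul_comm]
        refine Nat.mul_le_mul_left _ (le_trans ?_ ht)
        exact Nat.pow_le_pow_right two_pos (by omega)

lemma pow_four_mul_three_pow_le (s : ℕ) (hs : 100 ≤ s) :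
    8 * (s + 1) ^ 4 * 3 ^ (s - 1) ≤ 4 ^ (s - 1) := by
  induction s, hs using Nat.le_induction with
  | base => norm_num
  | succ s hs ih =>
    obtain ⟨w, rfl⟩ := Nat.exists_eq_add_of_le hs
    have e : 100 + w + 1 - 1 = 100 + w - 1 + 1 := by omega
    rw [e, pow_succ 3, pow_succ 4]
    have h : 3 * (100 + w + 1 + 1) ^ 4 ≤ 4 * (100 + w + 1) ^ 4 := by
      have h1 : 100 * (100 + w + 1 + 1) ≤ 101 * (100 + w + 1) := by omega
      have h2 := Nat.pow_le_pow_left h1 4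
      rw [mul_pow, mul_pow] at h2
      omega
    calc 8 * (100 + w + 1 + 1) ^ 4 * (3 ^ (100 + w - 1) * 3)
        = 8 * 3 ^ (100 + w - 1) * (3 * (100 + w + 1 + 1) ^ 4) := by ring
      _ ≤ 8 * 3 ^ (100 + w - 1) * (4 * (100 + w + 1) ^ 4) := Nat.mul_le_mul_left _ h
      _ = 8 * (100 + w + 1) ^ 4 * 3 ^ (100 + w - 1) * 4 := by ring
      _ ≤ 4 ^ (100 + w - 1) * 4 := Nat.mul_le_mul_right _ ih

lemma four_mul_sparse_term_le {d k s : ℕ} (hkd : k ≤ d) (hk : 2 ≤ k) (hs : 100 ≤ s)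
    (hsd : s ^ 2 ≤ d) (hds : d ≤ (s + 1) ^ 2) :
    4 * (k.choose s * (d.choose s * (2 ^ s * ((3 * 2 ^ (k - 2)) ^ (d - s) * (2 ^ k) ^ s)))) ≤
      (2 ^ k) ^ d := by
  obtain ⟨l, rfl⟩ := Nat.exists_eq_add_of_le hk
  rw [Nat.add_sub_cancel_left]
  obtain ⟨p, rfl⟩ := Nat.exists_eq_add_of_le' (show 1 ≤ s by omega)
  have hd : (p + 1) + (p + 1) * p ≤ d := by nlinarith
  obtain ⟨n, rfl⟩ := Nat.exists_eq_add_of_le hd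
  set s := p + 1
  set d := s + s * p + n
  have h1 : (2 + l).choose s ≤ ((s + 1) ^ 2) ^ s :=
    (Nat.choose_le_pow _ _).trans (Nat.pow_le_pow_left (hkd.trans hds) _)
  have h2 : d.choose s ≤ ((s + 1) ^ 2) ^ s :=
    (Nat.choose_le_pow _ _).trans (Nat.pow_le_pow_left hds _)
  have h3 := pow_four_mul_three_pow_le s hs
  have hp : s - 1 = p := rfl
  rw [hp] at h3
  have hds' : d - s = s * p + n := by omega
  have h4 : 4 ≤ 4 ^ s := Nat.le_self_pow (by omega) 4
  rw [hds']
  calc 4 * ((2 + l).choose s * (d.choose s * (2 ^ s * ((3 * 2 ^ l) ^ (s * p + n) *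
        (2 ^ (2 + l)) ^ s))))
      ≤ 4 ^ s * (((s + 1) ^ 2) ^ s * (((s + 1) ^ 2) ^ s * (2 ^ s * ((3 * 2 ^ l) ^ (s * p + n) *
        (2 ^ (2 + l)) ^ s)))) := by gcongr
    _ = (8 * (s + 1) ^ 4 * 3 ^ p) ^ s * 3 ^ n * ((2 ^ l) ^ (s * p + n) * (2 ^ (2 + l)) ^ s) := by
        have e8 : (8 : ℕ) ^ s = 4 ^ s * 2 ^ s := by rw [← mul_pow]; norm_num
        have e4 : ((s + 1) ^ 4) ^ s = ((s + 1) ^ 2) ^ s * ((s + 1) ^ 2) ^ s := by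
          rw [← mul_pow]; ring
        rw [mul_pow (8 * (s + 1) ^ 4), mul_pow 8, e8, e4, mul_pow 3, pow_add 3, ← pow_mul 3,
          mul_comm p s]
        ring
    _ ≤ (4 ^ p) ^ s * 4 ^ n * ((2 ^ l) ^ (s * p + n) * (2 ^ (2 + l)) ^ s) := by
        gcongr
        norm_num
    _ = (2 ^ (2 + l)) ^ d := by
        rw [show (4 : ℕ) = 2 ^ 2 by norm_num]
        simp only [← pow_mul, ← pow_add, d]
        congr 1
        ring

end Estimates

section WhiteWhaleBounds

open Finset

lemma ncard_vertices_pos (d : ℕ) : 1 ≤ (Set.extremePoints ℝ (whiteWhale d)).ncard := by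
  classical
  rw [ncard_vertices_eq, Nat.one_le_iff_ne_zero, card_ne_zero]
  obtain ⟨X, hX⟩ := exists_isSignPattern_of_linearIndepOn
    (fun a : whaleGens d => (a : Fin d → ℝ)) ∅ (by simp)
    (fun a _ => by simpa using a.2.1)
  exact ⟨_, mem_filter.2 ⟨mem_univ _, hX ∅ (Subset.refl _)⟩⟩

lemma ncard_vertices_le (d : ℕ) (hd : 2 ≤ d) :
    2 ^ (3 * (d - 1)) * (Set.extremePoints ℝ (whiteWhale d)).ncard ≤ (d + 4) * 2 ^ (d ^ 2) := by
  classical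
  have hpos : 0 < Fintype.card (whaleGens d) := by
    rw [card_whaleGens]
    have := Nat.one_lt_two_pow (n := d) (by omega)
    omega
  have : Nonempty (whaleGens d) := Fintype.card_pos_iff.1 hpos
  have h := card_isSignPattern_le (fun a : whaleGens d => (a : Fin d → ℝ))
  rw [card_whaleGens, Module.finrank_fin_fun] at h
  refine le_trans (Nat.mul_le_mul_left _ ?_) (sum_choose_two_pow_le d hd)
  rw [ncard_vertices_eq]
  exact h

lemma two_pow_le_two_mul_ncard_vertices {d k s : ℕ} (hkd : k ≤ d) (hsk : s ≤ k) (hs : 100 ≤ s)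
    (hsd : s ^ 2 ≤ d) (hds : d ≤ (s + 1) ^ 2) (ht : 2 ^ (12 * d) ≤ d ^ (d - k)) :
    2 ^ (k * d) ≤ 2 * (d ^ d * (Set.extremePoints ℝ (whiteWhale d)).ncard) := by
  have h1 := two_pow_le_ncard_vertices hkd hsk (by omega)
  have h2 := four_mul_dense_term_le hkd hsk (by omega) hds ht
  have h3 := four_mul_sparse_term_le hkd (by omega) hs hsd hds
  have h4 : k ^ k ≤ d ^ d :=
    (Nat.pow_le_pow_left hkd k).trans (Nat.pow_le_pow_right (by omega) hkd)
  have h5 := Nat.mul_le_mul_right (Set.extremePoints ℝ (whiteWhale d)).ncard h4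
  rw [pow_mul]
  omega

lemma two_rpow_le_ncard_vertices {d : ℕ} (hL : 10 < Real.log d) :
    (2 : ℝ) ^ ((d : ℝ) ^ 2 * (1 - 10 / Real.log d)) ≤
      ((Set.extremePoints ℝ (whiteWhale d)).ncard : ℝ) := by
  set L := Real.log d with hLdef
  have hL0 : 0 < L := by linarith
  have hdpos : (0 : ℝ) < d := by
    rcases Nat.eq_zero_or_pos d with h | h
    · subst h
      simp at hLdef
      linarith
    · exact_mod_cast h
  have hdexp : (d : ℝ) = Real.exp L := (Real.exp_log hdpos).symm
  have hdL : 2 * L ^ 2 + 2 * L ≤ d := by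
    have h := Real.pow_div_factorial_le_exp L hL0.le 4
    rw [← hdexp] at h
    have h24 : ((4 : ℕ).factorial : ℝ) = 24 := by norm_num [Nat.factorial]
    rw [h24] at h
    have h100 : 100 ≤ L ^ 2 := by nlinarith
    have h2 : 100 * L ^ 2 ≤ L ^ 4 :=
      calc 100 * L ^ 2 ≤ L ^ 2 * L ^ 2 := by gcongr
        _ = L ^ 4 := by ring
    nlinarith
  have hd : 10000 ≤ d := by
    have h1 : Real.exp 10 ≤ d := by rw [hdexp]; exact Real.exp_le_exp.2 hL.le
    have h2 : Real.exp 10 = Real.exp 1 ^ 10 := by rw [← Real.exp_nat_mul]; norm_num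
    have h3 : (2.7 : ℝ) ^ 10 ≤ Real.exp 1 ^ 10 :=
      pow_le_pow_left₀ (by norm_num) (by linarith [Real.exp_one_gt_d9]) 10
    have h4 : (10000 : ℝ) ≤ d := by
      refine le_trans ?_ (h3.trans (h2 ▸ h1))
      norm_num
    exact_mod_cast h4
  set t := ⌈9 * (d : ℝ) / L⌉₊
  have ht1 : 9 * (d : ℝ) / L ≤ t := Nat.le_ceil _
  have ht2 : (t : ℝ) < 9 * (d : ℝ) / L + 1 := Nat.ceil_lt_add_one (by positivity)
  have ht3 : 10 * t ≤ 9 * d + 10 := by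
    have : 9 * (d : ℝ) / L ≤ 9 * d / 10 :=
      div_le_div_of_nonneg_left (by positivity) (by norm_num) hL.le
    have : (10 * t : ℝ) ≤ 9 * d + 10 := by linarith
    exact_mod_cast this
  set s := Nat.sqrt d
  have hs : 100 ≤ s := Nat.le_sqrt'.2 (by omega)
  have hsd : s ^ 2 ≤ d := Nat.sqrt_le' d
  have hds : d ≤ (s + 1) ^ 2 := (Nat.lt_succ_sqrt' d).le
  have hsk : s ≤ d - t := by
    have : 100 * s ≤ d := le_trans (by nlinarith) hsd
    omega
  have htd : t ≤ d := by omega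
  have hpow : 2 ^ (12 * d) ≤ d ^ (d - (d - t)) := by
    rw [Nat.sub_sub_self htd]
    have hreal : (2 : ℝ) ^ (12 * d) ≤ (d : ℝ) ^ t := by
      rw [← Real.log_le_log_iff (by positivity) (by positivity), Real.log_pow, Real.log_pow]
      have h1 : 9 * (d : ℝ) ≤ t * L := (div_le_iff₀ hL0).1 ht1
      have h2 := Real.log_two_lt_d9
      push_cast
      nlinarith
    exact_mod_cast hreal
  have hmain := two_pow_le_two_mul_ncard_vertices (Nat.sub_le d t) hsk hs hsd hds hpow
  have hreal : (2 : ℝ) ^ ((d - t) * d) ≤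
      2 * ((d : ℝ) ^ d * ((Set.extremePoints ℝ (whiteWhale d)).ncard : ℝ)) := by
    exact_mod_cast hmain
  have hd2 : (d : ℝ) ≤ 2 ^ (2 * L) := by
    rw [Real.rpow_def_of_pos two_pos, ← Real.exp_log hdpos, ← hLdef]
    refine Real.exp_le_exp.2 ?_
    nlinarith [Real.log_two_gt_d9]
  have hdd : (d : ℝ) ^ d ≤ 2 ^ (2 * L * d) := by
    rw [Real.rpow_mul two_pos.le, Real.rpow_natCast]
    exact pow_le_pow_left₀ hdpos.le hd2 d
  have hexp : (d : ℝ) ^ 2 * (1 - 10 / L) + (1 + 2 * L * d) ≤ (((d - t) * d : ℕ) : ℝ) := by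
    rw [Nat.cast_mul, Nat.cast_sub htd]
    have h1 : 2 * L + 2 ≤ d / L := by
      rw [le_div_iff₀ hL0]
      nlinarith
    have h2 : (d : ℝ) - (9 * (d / L) + 1) ≤ d - t := by
      have : 9 * (d : ℝ) / L = 9 * (d / L) := mul_div_assoc _ _ _
      linarith
    have h3 := mul_le_mul_of_nonneg_right h2 hdpos.le
    have h4 := mul_le_mul_of_nonneg_right h1 hdpos.le
    have h5 : (d : ℝ) ^ 2 * (1 - 10 / L) = d ^ 2 - 10 * (d / L * d) := by
      field_simp
    have h6 : (1 : ℝ) ≤ d := by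
      have : (10000 : ℝ) ≤ d := by exact_mod_cast hd
      linarith
    rw [h5]
    nlinarith
  have hfin : (2 : ℝ) ^ ((d : ℝ) ^ 2 * (1 - 10 / L)) * 2 ^ (1 + 2 * L * d) ≤
      ((Set.extremePoints ℝ (whiteWhale d)).ncard : ℝ) * 2 ^ (1 + 2 * L * d) := by
    rw [← Real.rpow_add two_pos]
    refine (Real.rpow_le_rpow_of_exponent_le one_le_two hexp).trans ?_
    rw [Real.rpow_natCast]
    refine hreal.trans ?_
    rw [Real.rpow_add two_pos, Real.rpow_one]
    have := mul_le_mul_of_nonneg_right hdd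
      (Nat.cast_nonneg (α := ℝ) (Set.extremePoints ℝ (whiteWhale d)).ncard)
    linarith
  exact le_of_mul_le_mul_right hfin (by positivity)

end WhiteWhaleBounds

/-- Bounds on the number of vertices a(d) of the White Whale. -/
theorem whiteWhale_vertexCount_bounds (d : ℕ) (hd : 2 ≤ d) :
    ((d : ℝ) + 1) / 2 ^ (d + 1) * (2 : ℝ) ^ ((d : ℝ) ^ 2 * (1 - 10 / Real.log d)) ≤
      ((Set.extremePoints ℝ (whiteWhale d)).ncard : ℝ) ∧
    ((Set.extremePoints ℝ (whiteWhale d)).ncard : ℝ) ≤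
      ((d : ℝ) + 4) / 2 ^ (3 * (d - 1)) * 2 ^ (d ^ 2) := by
  constructor
  · have hfac : ((d : ℝ) + 1) / 2 ^ (d + 1) ≤ 1 := by
      rw [div_le_one (by positivity)]
      exact_mod_cast (Nat.lt_two_pow_self (n := d + 1)).le
    have hle : (2 : ℝ) ^ ((d : ℝ) ^ 2 * (1 - 10 / Real.log d)) ≤
        ((Set.extremePoints ℝ (whiteWhale d)).ncard : ℝ) := by
      rcases lt_or_ge 10 (Real.log d) with hL | hL
      · exact two_rpow_le_ncard_vertices hL
      · have hL0 : 0 < Real.log d := Real.log_pos (by exact_mod_cast (by omega : 1 < d))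
        have hdiv : 1 ≤ 10 / Real.log d := (one_le_div hL0).2 hL
        calc (2 : ℝ) ^ ((d : ℝ) ^ 2 * (1 - 10 / Real.log d)) ≤ 1 :=
              Real.rpow_le_one_of_one_le_of_nonpos one_le_two
                (mul_nonpos_of_nonneg_of_nonpos (by positivity) (by linarith))
          _ ≤ _ := by exact_mod_cast ncard_vertices_pos d
    calc _ ≤ 1 * (2 : ℝ) ^ ((d : ℝ) ^ 2 * (1 - 10 / Real.log d)) := by gcongr
      _ ≤ _ := by rwa [one_mul]
  · rw [div_mul_eq_mul_div, le_div_iff₀ (by positivity), mul_comm]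
    exact_mod_cast ncard_vertices_le d hd
end

section
/- For every d ≥ 3, the set of canonical vertices of the White Whale H_∞^+(d,1) that are sums of exactly 3 generators is {(0,…,0,2,2), (0,…,0,1,1,3)}: a point v with nondecreasing coordinates is a vertex of H_∞^+(d,1) of the form p(S) with S ⊆ G_d and |S| = 3 if and only if v is one of these two points. -/
open Finset

/-- The `0/1`-vector with support `A`. -/
noncomputable def charVec {d : ℕ} (A : Finset (Fin d)) : Fin d → ℝ :=
  fun i => if i ∈ A then 1 else 0

theorem charVec_injective {d : ℕ} : Function.Injective (charVec (d := d)) := by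
  intro A B h
  ext i
  have := congrFun h i
  by_cases hA : i ∈ A <;> by_cases hB : i ∈ B <;> simp_all [charVec]

theorem charVec_ne_zero {d : ℕ} {A : Finset (Fin d)} (hA : A.Nonempty) : charVec A ≠ 0 := by
  obtain ⟨i, hi⟩ := hA
  intro h
  simpa [charVec, hi] using congrFun h i

theorem charVec_union {d : ℕ} {A B : Finset (Fin d)} (h : Disjoint A B) :
    charVec (A ∪ B) = charVec A + charVec B := by
  ext i
  have := fun hA : i ∈ A => Finset.disjoint_left.mp h hA
  by_cases hA : i ∈ A <;> by_cases hB : i ∈ B <;> simp_all [charVec]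

theorem image_charVec_subset {d : ℕ} {F : Finset (Finset (Fin d))} (hF : ∅ ∉ F) :
    charVec '' (F : Set (Finset (Fin d))) ⊆ whaleGens d := by
  rintro _ ⟨A, hA, rfl⟩
  refine ⟨charVec_ne_zero (nonempty_iff_ne_empty.mpr fun h => hF (h ▸ hA)), fun i => ?_⟩
  by_cases hi : i ∈ A <;> simp [charVec, hi]

theorem exists_eq_image_charVec {d : ℕ} {S : Set (Fin d → ℝ)} (hS : S ⊆ whaleGens d) :
    ∃ F : Finset (Finset (Fin d)), ∅ ∉ F ∧ S = charVec '' (F : Set (Finset (Fin d))) := by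
  classical
  refine ⟨univ.filter fun A => charVec A ∈ S, fun h => ?_, ?_⟩
  · refine (hS (mem_filter.mp h).2).1 ?_
    ext i
    simp [charVec]
  · ext g
    simp only [coe_filter, mem_univ, true_and, Set.mem_image, Set.mem_ofPred_eq]
    refine ⟨fun hg => ?_, fun ⟨A, hA, h⟩ => h ▸ hA⟩
    have : charVec (univ.filter fun i => g i = 1) = g := by
      ext i
      rcases (hS hg).2 i with h | h <;> simp [charVec, h]
    exact ⟨_, this.symm ▸ hg, this⟩

theorem whaleSum_image_charVec {d : ℕ} (F : Finset (Finset (Fin d))) :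
    whaleSum (charVec '' (F : Set (Finset (Fin d)))) = ∑ A ∈ F, charVec A := by
  rw [whaleSum, finsum_mem_image charVec_injective.injOn, finsum_mem_coe_finset]

theorem sum_charVec_mem_whiteWhale {d : ℕ} {F : Finset (Finset (Fin d))} (hF : ∅ ∉ F) :
    ∑ A ∈ F, charVec A ∈ whiteWhale d :=
  subset_convexHull ℝ _ ⟨_, image_charVec_subset hF, (whaleSum_image_charVec F).symm⟩

/-- At a vertex, no nontrivial sum of chosen generators equals a sum of other generators. -/
theorem IsWhaleVertex.sum_eq_zero_of_exchange {d : ℕ} {F P Q : Finset (Finset (Fin d))}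
    (hv : IsWhaleVertex d (∑ A ∈ F, charVec A)) (hF : ∅ ∉ F) (hP : P ⊆ F) (hQ : Disjoint F Q)
    (hQ₀ : ∅ ∉ Q) (h : ∑ A ∈ P, charVec A = ∑ A ∈ Q, charVec A) :
    ∑ A ∈ P, charVec A = 0 := by
  have h₁ : ∑ A ∈ F \ P, charVec A ∈ whiteWhale d :=
    sum_charVec_mem_whiteWhale fun h => hF (mem_sdiff.mp h).1
  have h₂ : ∑ A ∈ F ∪ Q, charVec A ∈ whiteWhale d :=
    sum_charVec_mem_whiteWhale fun h => (mem_union.mp h).elim hF hQ₀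
  have e₁ := sum_sdiff (f := charVec) hP
  have e₂ := sum_union (f := charVec) hQ
  have := hv.2 h₁ h₂ ⟨1 / 2, 1 / 2, by norm_num, by norm_num, by norm_num, by
    rw [e₂, ← h, ← e₁]
    module⟩
  rw [this] at e₁
  simpa using e₁

theorem IsWhaleVertex.mem_or_mem_of_union_mem {d : ℕ} {F : Finset (Finset (Fin d))}
    (hv : IsWhaleVertex d (∑ A ∈ F, charVec A)) (hF : ∅ ∉ F) {A B : Finset (Fin d)}
    (hA : A.Nonempty) (hB : B.Nonempty) (hAB : Disjoint A B) (h : A ∪ B ∈ F) :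
    A ∈ F ∨ B ∈ F := by
  by_contra! hn
  have hne : A ≠ B := by
    rintro rfl
    exact hA.ne_empty (disjoint_self.mp hAB)
  refine charVec_ne_zero (hA.mono (subset_union_left (s₂ := B))) ?_
  simpa using hv.sum_eq_zero_of_exchange (P := {A ∪ B}) (Q := {A, B}) hF (by simpa using h)
    (by simp [hn]) (by simp [hA.ne_empty.symm, hB.ne_empty.symm])
    (by simp [sum_pair hne, charVec_union hAB])

theorem IsWhaleVertex.union_mem {d : ℕ} {F : Finset (Finset (Fin d))}
    (hv : IsWhaleVertex d (∑ A ∈ F, charVec A)) (hF : ∅ ∉ F) {A B : Finset (Fin d)}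
    (hAB : Disjoint A B) (hA : A ∈ F) (hB : B ∈ F) : A ∪ B ∈ F := by
  by_contra hn
  have hA₀ : A.Nonempty := nonempty_iff_ne_empty.mpr fun h => hF (h ▸ hA)
  have hne : A ≠ B := by
    rintro rfl
    exact hA₀.ne_empty (disjoint_self.mp hAB)
  refine charVec_ne_zero (hA₀.mono (subset_union_left (s₂ := B))) ?_
  rw [charVec_union hAB, ← sum_pair hne]
  exact hv.sum_eq_zero_of_exchange (Q := {A ∪ B}) hF (by simp [insert_subset_iff, hA, hB])
    (by simpa using hn) (by simpa using fun h => (hA₀.mono subset_union_left).ne_empty h.symm)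
    (by simp [sum_pair hne, charVec_union hAB])

section Families

variable {α : Type*} [DecidableEq α] {F : Finset (Finset α)}

theorem exists_singleton_mem_of_split (h₀ : ∅ ∉ F)
    (hsplit : ∀ A B : Finset α, A.Nonempty → B.Nonempty → Disjoint A B → A ∪ B ∈ F →
      A ∈ F ∨ B ∈ F) (A : Finset α) (hA : A ∈ F) : ∃ a ∈ A, {a} ∈ F := by
  induction A using Finset.strongInduction with
  | H A ih =>
    obtain ⟨a, ha⟩ : A.Nonempty := nonempty_iff_ne_empty.mpr fun h => h₀ (h ▸ hA)
    rcases (A.erase a).eq_empty_or_nonempty with h | h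
    · refine ⟨a, ha, ?_⟩
      rwa [← insert_erase ha, h] at hA
    · rcases hsplit {a} (A.erase a) (singleton_nonempty a) h (by simp)
        (by rwa [← insert_eq, insert_erase ha]) with h | h
      · exact ⟨a, ha, h⟩
      · obtain ⟨b, hb, hbF⟩ := ih _ (erase_ssubset ha) h
        exact ⟨b, mem_of_mem_erase hb, hbF⟩

theorem eq_pair_of_mem_of_split (hcard : F.card = 3) {a : α} (ha : {a} ∈ F)
    (hmem : ∀ A ∈ F, a ∈ A)
    (hsplit : ∀ A B : Finset α, A.Nonempty → B.Nonempty → Disjoint A B → A ∪ B ∈ F →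
      A ∈ F ∨ B ∈ F) {X : Finset α} (hX : X ∈ F) (hXa : X ≠ {a}) :
    ∃ b, b ≠ a ∧ X = {a, b} := by
  have haX := hmem X hX
  have herase : ∀ b ∈ X.erase a, X.erase b ∈ F := by
    intro b hb
    obtain ⟨hba, hbX⟩ := mem_erase.mp hb
    refine (hsplit {b} (X.erase b) (singleton_nonempty b) ⟨a, by simp [haX, hba.symm]⟩ (by simp)
      (by rwa [← insert_eq, insert_erase hbX])).resolve_left fun h => hba ?_
    exact (mem_singleton.mp (hmem _ h)).symm
  obtain ⟨b, hb⟩ : (X.erase a).Nonempty := by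
    rw [nonempty_iff_ne_empty]
    intro h
    exact hXa (by rw [← insert_erase haX, h]; rfl)
  have hb' := mem_erase.mp hb
  refine ⟨b, hb'.1, ?_⟩
  by_contra hne
  obtain ⟨c, hc, hcb⟩ : ∃ c ∈ X.erase a, c ≠ b := by
    by_contra! h
    refine hne ?_
    ext x
    have := h x
    simp only [mem_erase, mem_insert, mem_singleton] at this ⊢
    grind
  have hc' := mem_erase.mp hc
  have hsub : ({{a}, X, X.erase b, X.erase c} : Finset (Finset α)) ⊆ F := by
    simp [insert_subset_iff, ha, hX, herase b hb, herase c hc]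
  have h₁ : X ≠ X.erase b := fun h => by grind
  have h₂ : X ≠ X.erase c := fun h => by grind
  have h₃ : X.erase b ≠ X.erase c := fun h => by
    have : c ∈ X.erase b := by simp [hcb, hc'.2]
    simp [h] at this
  have h₄ : {a} ≠ X.erase b := fun h => by
    have : c ∈ X.erase b := by simp [hcb, hc'.2]
    simp [← h, hc'.1] at this
  have h₅ : {a} ≠ X.erase c := fun h => by
    have : b ∈ X.erase c := by simp [hcb.symm, hb'.2]
    simp [← h, hb'.1] at this
  have := card_le_card hsub
  rw [card_insert_of_notMem (by simp [hXa.symm, h₄, h₅]),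
    card_insert_of_notMem (by simp [h₁, h₂]), card_pair h₃] at this
  omega

theorem card_family_pair {a b : α} (hab : a ≠ b) :
    ({{a}, {b}, {a, b}} : Finset (Finset α)).card = 3 := by
  refine card_eq_three.mpr ⟨_, _, _, by simpa using hab, fun h => hab ?_, fun h => hab ?_, rfl⟩
  · exact (mem_singleton.mp (h.ge (mem_insert_of_mem (mem_singleton_self b)))).symm
  · exact mem_singleton.mp (h.ge (mem_insert_self a {b}))

theorem card_family_triple {a b c : α} (hba : b ≠ a) (hca : c ≠ a) (hbc : b ≠ c) :
    ({{a}, {a, b}, {a, c}} : Finset (Finset α)).card = 3 := by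
  refine card_eq_three.mpr ⟨_, _, _, fun h => hba ?_, fun h => hca ?_, fun h => ?_, rfl⟩
  · exact mem_singleton.mp (h.ge (mem_insert_of_mem (mem_singleton_self b)))
  · exact mem_singleton.mp (h.ge (mem_insert_of_mem (mem_singleton_self c)))
  · simpa [hba, hbc] using h.le (mem_insert_of_mem (mem_singleton_self b))

/-- Three-element families that are closed under disjoint unions and whose complement is too. -/
theorem family_three_classification (h₀ : ∅ ∉ F) (hcard : F.card = 3)
    (hsplit : ∀ A B : Finset α, A.Nonempty → B.Nonempty → Disjoint A B → A ∪ B ∈ F →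
      A ∈ F ∨ B ∈ F)
    (hunion : ∀ A B : Finset α, Disjoint A B → A ∈ F → B ∈ F → A ∪ B ∈ F) :
    (∃ a b, a ≠ b ∧ F = {{a}, {b}, {a, b}}) ∨
      ∃ a b c, b ≠ a ∧ c ≠ a ∧ b ≠ c ∧ F = {{a}, {a, b}, {a, c}} := by
  obtain ⟨A, hA⟩ : F.Nonempty := card_pos.mp (by omega)
  obtain ⟨a, -, ha⟩ := exists_singleton_mem_of_split h₀ hsplit A hA
  by_cases hex : ∃ b, a ≠ b ∧ {b} ∈ F
  · obtain ⟨b, hab, hb⟩ := hex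
    refine Or.inl ⟨a, b, hab, (eq_of_subset_of_card_le ?_ ?_).symm⟩
    · have := hunion {a} {b} (by simpa using hab) ha hb
      rw [← insert_eq] at this
      simp [insert_subset_iff, ha, hb, this]
    · rw [hcard, card_family_pair hab]
  · push Not at hex
    have hmem : ∀ A ∈ F, a ∈ A := by
      intro A hA
      obtain ⟨b, hb, hbF⟩ := exists_singleton_mem_of_split h₀ hsplit A hA
      by_contra hn
      exact hex b (fun h => hn (h ▸ hb)) hbF
    obtain ⟨X, Y, hXY, hF⟩ := card_eq_two.mp
      (show (F.erase {a}).card = 2 by rw [card_erase_of_mem ha, hcard])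
    have hX : X ∈ F.erase {a} := by simp [hF]
    have hY : Y ∈ F.erase {a} := by simp [hF]
    obtain ⟨b, hba, rfl⟩ := eq_pair_of_mem_of_split hcard ha hmem hsplit
      (mem_of_mem_erase hX) (ne_of_mem_erase hX)
    obtain ⟨c, hca, rfl⟩ := eq_pair_of_mem_of_split hcard ha hmem hsplit
      (mem_of_mem_erase hY) (ne_of_mem_erase hY)
    exact Or.inr ⟨a, b, c, hba, hca, fun h => hXY (by rw [h]), by rw [← hF, insert_erase ha]⟩

end Families

theorem sum_charVec_pair {d : ℕ} {a b : Fin d} (hab : a ≠ b) :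
    ∑ A ∈ {{a}, {b}, {a, b}}, charVec A =
      fun i => if i ∈ ({a, b} : Finset (Fin d)) then 2 else 0 := by
  have h₁ : ({b} : Finset (Fin d)) ≠ {a, b} := fun h => hab (by
    simpa using h.ge (mem_insert_self a {b}))
  have h₂ : ({a} : Finset (Fin d)) ≠ {a, b} := fun h => hab
    (mem_singleton.mp (h.ge (mem_insert_of_mem (mem_singleton_self b)))).symm
  rw [sum_insert (by simp [hab, h₂]), sum_pair h₁]
  ext i
  by_cases hia : i = a
  · subst hia
    norm_num [charVec, hab]
  · by_cases hib : i = b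
    · subst hib
      norm_num [charVec, hia]
    · simp [charVec, hia, hib]

theorem sum_charVec_triple {d : ℕ} {a b c : Fin d} (hba : b ≠ a) (hca : c ≠ a) (hbc : b ≠ c) :
    ∑ A ∈ {{a}, {a, b}, {a, c}}, charVec A = fun i =>
      if i ∈ ({a} : Finset (Fin d)) then 3
      else if i ∈ ({a, b, c} : Finset (Fin d)) then 1 else 0 := by
  have h₁ : ({a} : Finset (Fin d)) ≠ {a, b} := fun h => hba
    (mem_singleton.mp (h.ge (mem_insert_of_mem (mem_singleton_self b))))
  have h₂ : ({a} : Finset (Fin d)) ≠ {a, c} := fun h => hca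
    (mem_singleton.mp (h.ge (mem_insert_of_mem (mem_singleton_self c))))
  have h₃ : ({a, b} : Finset (Fin d)) ≠ {a, c} := fun h => by
    simpa [hba, hbc] using h.le (mem_insert_of_mem (mem_singleton_self b))
  rw [sum_insert (by simp [h₁, h₂]), sum_pair h₃]
  ext i
  by_cases hia : i = a
  · subst hia
    norm_num [charVec]
  · by_cases hib : i = b
    · subst hib
      norm_num [charVec, hia, hbc]
    · by_cases hic : i = c
      · subst hic
        norm_num [charVec, hia, hib]
      · simp [charVec, hia, hib, hic]

theorem mem_iff_of_isUpperSet {d : ℕ} {U : Finset (Fin d)} (hU : IsUpperSet (U : Set (Fin d)))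
    (i : Fin d) : i ∈ U ↔ d - U.card ≤ (i : ℕ) := by
  have := i.isLt
  constructor
  · intro hi
    have h : Finset.Ici i ⊆ U := fun j hj => hU (Finset.mem_Ici.mp hj) hi
    have := card_le_card h
    rw [Fin.card_Ici] at this
    omega
  · contrapose!
    intro hi
    have h : U ⊆ Finset.Ioi i := fun j hj => Finset.mem_Ioi.mpr (by
      by_contra! hji
      exact hi (hU hji hj))
    have := card_le_card h
    rw [Fin.card_Ioi] at this
    omega

theorem isUpperSet_of_monotone {ι : Type*} [Preorder ι] {v : ι → ℝ} (hv : Monotone v)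
    {U : Finset ι} (t : ℝ) (hU : ∀ i, i ∈ U ↔ t ≤ v i) : IsUpperSet (U : Set ι) :=
  fun i j hij hi => (hU j).mpr (((hU i).mp hi).trans (hv hij))

theorem sum_lt_sum_of_ne {β : Type*} [DecidableEq β] {F T : Finset β} {w : β → ℝ}
    (hpos : ∀ A ∈ F, 0 < w A) (hneg : ∀ A ∈ T, A ∉ F → w A < 0) (hne : T ≠ F) :
    ∑ A ∈ T, w A < ∑ A ∈ F, w A := by
  rw [← sum_inter_add_sum_sdiff T F w, ← sum_inter_add_sum_sdiff F T w, inter_comm F T]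
  have h₁ : ∑ A ∈ T \ F, w A ≤ 0 := sum_nonpos fun A hA =>
    (hneg A (mem_sdiff.mp hA).1 (mem_sdiff.mp hA).2).le
  have h₂ : 0 ≤ ∑ A ∈ F \ T, w A := sum_nonneg fun A hA => (hpos A (mem_sdiff.mp hA).1).le
  by_cases h : F ⊆ T
  · have : (T \ F).Nonempty := sdiff_nonempty.mpr fun h' => hne (h'.antisymm h)
    have := sum_neg (fun A hA => hneg A (mem_sdiff.mp hA).1 (mem_sdiff.mp hA).2) this
    linarith
  · have := sum_pos (fun A hA => hpos A (mem_sdiff.mp hA).1) (sdiff_nonempty.mpr h)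
    linarith

theorem dotProduct_charVec {d : ℕ} (c : Fin d → ℝ) (A : Finset (Fin d)) :
    c ⬝ᵥ charVec A = ∑ i ∈ A, c i := by
  simp [dotProduct, charVec]

theorem isWhaleVertex_of_separated {d : ℕ} {F : Finset (Finset (Fin d))} (c : Fin d → ℝ)
    (hF : ∅ ∉ F) (hpos : ∀ A ∈ F, 0 < ∑ i ∈ A, c i)
    (hneg : ∀ A : Finset (Fin d), A.Nonempty → A ∉ F → ∑ i ∈ A, c i < 0) :
    IsWhaleVertex d (∑ A ∈ F, charVec A) := by
  set v := ∑ A ∈ F, charVec A with hv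
  have key : whiteWhale d ⊆ {x | x = v ∨ c ⬝ᵥ x < c ⬝ᵥ v} := by
    refine convexHull_min ?_ ?_
    · rintro _ ⟨S, hS, rfl⟩
      obtain ⟨T, hT, rfl⟩ := exists_eq_image_charVec hS
      rw [whaleSum_image_charVec]
      by_cases hTF : T = F
      · exact Or.inl (by rw [hTF])
      · refine Or.inr ?_
        simp only [hv, dotProduct_sum, dotProduct_charVec]
        exact sum_lt_sum_of_ne hpos
          (fun A hA => hneg A (nonempty_iff_ne_empty.mpr fun h => hT (h ▸ hA))) hTF
    · intro x hx y hy s t hs ht hst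
      have e : c ⬝ᵥ (s • x + t • y) = s * (c ⬝ᵥ x) + t * (c ⬝ᵥ y) := by
        simp [dotProduct_add, dotProduct_smul]
      simp only [Set.mem_ofPred_eq, e]
      rcases hs.eq_or_lt with rfl | hs
      · obtain rfl : t = 1 := by linarith
        simpa using hy
      rcases ht.eq_or_lt with rfl | ht
      · obtain rfl : s = 1 := by linarith
        simpa using hx
      obtain rfl : t = 1 - s := by linarith
      rcases hx with rfl | hx <;> rcases hy with rfl | hy
      · left
        module
      all_goals right; nlinarith
  refine ⟨sum_charVec_mem_whiteWhale hF, ?_⟩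
  rintro x hx y hy ⟨s, t, hs, ht, hst, hxy⟩
  refine (key hx).resolve_right fun hlt => ?_
  have hy' : c ⬝ᵥ y ≤ c ⬝ᵥ v := (key hy).elim (fun h => by rw [h]) le_of_lt
  have e : s * (c ⬝ᵥ x) + t * (c ⬝ᵥ y) = c ⬝ᵥ v := by
    rw [← hxy]
    simp [dotProduct_add, dotProduct_smul]
  obtain rfl : t = 1 - s := by linarith
  nlinarith

theorem isWhaleVertex_pair {d : ℕ} {a b : Fin d} (hab : a ≠ b) :
    IsWhaleVertex d (∑ A ∈ {{a}, {b}, {a, b}}, charVec A) := by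
  refine isWhaleVertex_of_separated (fun i => if i = a ∨ i = b then 1 else -3)
    (by simp [(insert_ne_empty _ _).symm]) ?_ ?_
  · intro A hA
    simp only [mem_insert, mem_singleton] at hA
    rcases hA with rfl | rfl | rfl <;> simp [sum_pair hab]
  · intro A hA hAF
    have hsub : ¬ A ⊆ {a, b} := by
      intro h
      obtain ⟨x, hx⟩ := hA
      simp only [mem_insert, mem_singleton, not_or] at hAF
      by_cases ha : a ∈ A <;> by_cases hb : b ∈ A <;> grind
    obtain ⟨j, hj, hjab⟩ := not_subset.mp hsub
    rw [← add_sum_erase A _ hj]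
    simp only [mem_insert, mem_singleton] at hjab
    rw [if_neg hjab]
    have : ∑ i ∈ A.erase j, (if i = a ∨ i = b then (1 : ℝ) else -3) ≤
        ∑ i ∈ {a, b}, 1 := by
      refine (sum_le_sum (g := fun i => if i ∈ ({a, b} : Finset (Fin d)) then (1 : ℝ) else 0)
        fun i _ => ?_).trans ?_
      · simp only [mem_insert, mem_singleton]
        split_ifs <;> norm_num
      · rw [← sum_filter]
        exact sum_le_sum_of_subset_of_nonneg (fun i hi => (mem_filter.mp hi).2) (by simp)
    rw [sum_pair hab] at this
    linarith

theorem isWhaleVertex_triple {d : ℕ} {a b c : Fin d} (hba : b ≠ a) (hca : c ≠ a) :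
    IsWhaleVertex d (∑ A ∈ {{a}, {a, b}, {a, c}}, charVec A) := by
  set w : Fin d → ℝ := fun i => if i = a then 3 else if i = b ∨ i = c then -2 else -4 with hw
  have hle : ∀ i, i ≠ a → w i ≤ -2 := by
    intro i hi
    simp only [hw, if_neg hi]
    split_ifs <;> norm_num
  refine isWhaleVertex_of_separated w (by simp [(insert_ne_empty _ _).symm]) ?_ ?_
  · intro A hA
    simp only [mem_insert, mem_singleton] at hA
    rcases hA with rfl | rfl | rfl
    · simp [hw]
    · rw [sum_pair hba.symm]
      norm_num [hw, hba]
    · rw [sum_pair hca.symm]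
      norm_num [hw, hca]
  · intro A hA hAF
    by_cases haA : a ∈ A
    · rw [← add_sum_erase A _ haA]
      have hwa : w a = 3 := by simp [hw]
      have hneg : ∀ i ∈ A.erase a, w i ≤ -2 := fun i hi => hle i (ne_of_mem_erase hi)
      obtain ⟨j, hj⟩ : (A.erase a).Nonempty := by
        rw [nonempty_iff_ne_empty]
        intro h
        have := insert_erase haA
        simp_all
      rw [← add_sum_erase _ _ hj]
      rcases ((A.erase a).erase j).eq_empty_or_nonempty with h | ⟨k, hk⟩
      · have e : A = {a, j} := by
          rw [← insert_erase haA, ← insert_erase hj, h]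
          rfl
        have hjb : j ≠ b ∧ j ≠ c := by
          constructor <;> rintro rfl <;> exact hAF (by simp [e])
        have : w j = -4 := by simp [hw, hjb, ne_of_mem_erase hj]
        rw [h, sum_empty]
        linarith
      · rw [← add_sum_erase _ _ hk]
        have h₁ := hneg j hj
        have h₂ := hneg k (mem_of_mem_erase hk)
        have h₃ : ∑ i ∈ ((A.erase a).erase j).erase k, w i ≤ 0 := sum_nonpos fun i hi => by
          linarith [hneg i (mem_of_mem_erase (mem_of_mem_erase hi))]
        linarith
    · exact sum_neg (fun i hi => by linarith [hle i fun h => haA (h ▸ hi)]) hA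

theorem exists_whaleSum_eq_sum_charVec {d : ℕ} {F : Finset (Finset (Fin d))} (hF : ∅ ∉ F) :
    ∃ S : Set (Fin d → ℝ), S ⊆ whaleGens d ∧ S.ncard = F.card ∧
      whaleSum S = ∑ A ∈ F, charVec A :=
  ⟨_, image_charVec_subset hF, by
    rw [Set.ncard_image_of_injective _ charVec_injective, Set.ncard_coe_finset],
    whaleSum_image_charVec F⟩

/-- For d ≥ 3, a point with nondecreasing coordinates is a vertex of the White
Whale that is the sum of exactly 3 generators if and only if it is one of
(0,…,0,2,2) and (0,…,0,1,1,3). -/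
theorem whale_layer_three (d : ℕ) (hd : 3 ≤ d) (v : Fin d → ℝ) (hv : Monotone v) :
    (IsWhaleVertex d v ∧
      ∃ S : Set (Fin d → ℝ), S ⊆ whaleGens d ∧ S.ncard = 3 ∧ whaleSum S = v) ↔
    ((v = fun i : Fin d => if d - 2 ≤ (i : ℕ) then 2 else 0) ∨
     (v = fun i : Fin d =>
        if (i : ℕ) = d - 1 then 3 else if d - 3 ≤ (i : ℕ) then 1 else 0)) := by
  constructor
  · rintro ⟨hvert, S, hS, hcard, rfl⟩
    obtain ⟨F, hF, rfl⟩ := exists_eq_image_charVec hS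
    rw [Set.ncard_image_of_injective _ charVec_injective, Set.ncard_coe_finset] at hcard
    rw [whaleSum_image_charVec] at hvert hv ⊢
    rcases family_three_classification hF hcard
      (fun A B hA hB hAB h => hvert.mem_or_mem_of_union_mem hF hA hB hAB h)
      (fun A B hAB hA hB => hvert.union_mem hF hAB hA hB) with
      ⟨a, b, hab, rfl⟩ | ⟨a, b, c, hba, hca, hbc, rfl⟩
    · left
      rw [sum_charVec_pair hab] at hv ⊢
      have hU := isUpperSet_of_monotone hv (U := {a, b}) 2 fun i => by
        split_ifs with h <;> simp [h]
      ext i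
      simp only [mem_iff_of_isUpperSet hU i, card_pair hab]
    · right
      rw [sum_charVec_triple hba hca hbc] at hv ⊢
      have hU := isUpperSet_of_monotone hv (U := {a}) 3 fun i => by
        split_ifs with h <;> norm_num [h]
      have hU' := isUpperSet_of_monotone hv (U := {a, b, c}) 1 fun i => by
        split_ifs with h h' <;> simp_all
      have h3 : ({a, b, c} : Finset (Fin d)).card = 3 :=
        card_eq_three.mpr ⟨a, b, c, hba.symm, hca.symm, hbc, rfl⟩
      ext i
      have : d - 1 ≤ (i : ℕ) ↔ (i : ℕ) = d - 1 := by omega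
      simp only [mem_iff_of_isUpperSet hU i, mem_iff_of_isUpperSet hU' i, h3, card_singleton, this]
  · obtain ⟨a, ha⟩ : ∃ a : Fin d, (a : ℕ) = d - 1 := ⟨⟨d - 1, by omega⟩, rfl⟩
    obtain ⟨b, hb⟩ : ∃ b : Fin d, (b : ℕ) = d - 2 := ⟨⟨d - 2, by omega⟩, rfl⟩
    obtain ⟨c, hc⟩ : ∃ c : Fin d, (c : ℕ) = d - 3 := ⟨⟨d - 3, by omega⟩, rfl⟩
    have hba : b ≠ a := by
      rw [ne_eq, Fin.ext_iff]
      omega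
    have hca : c ≠ a := by
      rw [ne_eq, Fin.ext_iff]
      omega
    have hbc : b ≠ c := by
      rw [ne_eq, Fin.ext_iff]
      omega
    rintro (h | h)
    · obtain rfl : v = ∑ A ∈ {{a}, {b}, {a, b}}, charVec A := by
        rw [sum_charVec_pair hba.symm, h]
        ext i
        refine if_congr ?_ rfl rfl
        simp only [mem_insert, mem_singleton, Fin.ext_iff]
        omega
      refine ⟨isWhaleVertex_pair hba.symm, ?_⟩
      rw [← card_family_pair hba.symm]
      exact exists_whaleSum_eq_sum_charVec (by simp [(insert_ne_empty _ _).symm])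
    · obtain rfl : v = ∑ A ∈ {{a}, {a, b}, {a, c}}, charVec A := by
        rw [sum_charVec_triple hba hca hbc, h]
        ext i
        refine if_congr ?_ rfl (if_congr ?_ rfl rfl) <;>
        · simp only [mem_insert, mem_singleton, Fin.ext_iff]
          omega
      refine ⟨isWhaleVertex_triple hba hca, ?_⟩
      rw [← card_family_triple hba hca hbc]
      exact exists_whaleSum_eq_sum_charVec (by simp [(insert_ne_empty _ _).symm])
end
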